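/- Let n ≥ 3 be an integer and l = max(⌊(n-1)/2⌋+5, n+1). For any decreasing function ψ : ℕ → ℝ⁺, any s > (n-1)/2, and any compact C^l hypersurface S ⊆ ℝ^n with nonvanishing Gaussian curvature everywhere except possibly on a set of zero Hausdorff s-measure: if Σ_{q=1}^∞ (ψ(q)/q)^{s+1} q^n < ∞, then H^s(𝒮_n(ψ) ∩ S) = 0. -/

import Mathlib

open MeasureTheory

/-- Distance from a real number to the nearest integer. -/
noncomputable def nint (θ : ℝ) : ℝ := |θ - round θ|

/-- Hessian matrix of `f` at `x`. -/
noncomputable def hess {m : ℕ} (f : (Fin m → ℝ) → ℝ) (x : Fin m → ℝ) :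
    Matrix (Fin m) (Fin m) ℝ :=
  Matrix.of fun i j => fderiv ℝ (fun y => fderiv ℝ f y (Pi.single j 1)) x (Pi.single i 1)

/-- Append a last coordinate to a vector in `ℝ^m`, viewed inside `ℝ^n` (`m = n - 1`). -/
noncomputable def appendV (n m : ℕ) (y : Fin m → ℝ) (z : ℝ) : Fin n → ℝ :=
  fun i => if h : (i : ℕ) < m then y ⟨i, h⟩ else z

/-- The set `𝒮_n(ψ)` of simultaneously `ψ`-approximable points of `ℝ^n`. -/
def simulApprox (n : ℕ) (ψ : ℕ → ℝ) : Set (Fin n → ℝ) :=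
  {x | {q : ℤ | q ≠ 0 ∧ ∀ i, nint ((q : ℝ) * x i) < ψ q.natAbs}.Infinite}

section LatticeDuality

variable {ι : Type}

/-- The real vector underlying an integer vector. -/
def toRealVec (w : ι → ℤ) : ι → ℝ := fun i => (w i : ℝ)

lemma toRealVec_sub (w w' : ι → ℤ) : toRealVec (w - w') = toRealVec w - toRealVec w' := by
  ext i; simp [toRealVec]

variable [Fintype ι]

lemma integral_cos_dotProduct_unitCube (m : ι → ℤ) (hm : m ≠ 0) :
    ∫ x in Set.univ.pi (fun _ : ι => Set.Ioc (0 : ℝ) 1),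
      Real.cos (2 * Real.pi * (toRealVec m ⬝ᵥ x)) = 0 := by
  obtain ⟨i, hi⟩ := Function.ne_iff.mp hm
  set μ : Measure (ι → ℝ) := volume.restrict (Set.univ.pi (fun _ : ι => Set.Ioc (0 : ℝ) 1)) with hμ
  have hμ' : μ = Measure.pi fun _ : ι => (volume : Measure ℝ).restrict (Set.Ioc (0 : ℝ) 1) := by
    rw [hμ, volume_pi, Measure.restrict_pi_pi]
  have hprod : ∀ x : ι → ℝ, Complex.exp (2 * Real.pi * Complex.I * ((toRealVec m ⬝ᵥ x : ℝ) : ℂ)) =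
      ∏ j, Complex.exp (2 * Real.pi * Complex.I * (m j : ℂ) * (x j : ℂ)) := by
    intro x
    rw [← Complex.exp_sum]
    congr 1
    simp only [dotProduct, toRealVec]
    push_cast
    rw [Finset.mul_sum]
    exact Finset.sum_congr rfl fun j _ => by ring
  have hzero : ∫ x, Complex.exp (2 * Real.pi * Complex.I * ((toRealVec m ⬝ᵥ x : ℝ) : ℂ)) ∂μ = 0 := by
    simp_rw [hprod]
    rw [hμ', integral_fintype_prod_eq_prod
      (f := fun j (y : ℝ) => Complex.exp (2 * Real.pi * Complex.I * (m j : ℂ) * (y : ℂ)))]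
    refine Finset.prod_eq_zero (Finset.mem_univ i) ?_
    rw [← intervalIntegral.integral_of_le zero_le_one, integral_exp_mul_complex]
    · have : Complex.exp (2 * Real.pi * Complex.I * (m i : ℂ) * ((1 : ℝ) : ℂ)) = 1 := by
        rw [Complex.exp_eq_one_iff]
        exact ⟨m i, by push_cast; ring⟩
      rw [this]; simp
    · have : (m i : ℂ) ≠ 0 := by exact_mod_cast hi
      simp [Real.pi_ne_zero, this]
  have hint : Integrable
      (fun x : ι → ℝ => Complex.exp (2 * Real.pi * Complex.I * ((toRealVec m ⬝ᵥ x : ℝ) : ℂ))) μ := by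
    have : IsFiniteMeasure μ := by
      rw [hμ']; infer_instance
    refine Integrable.of_bound (C := 1) ?_ ?_
    · refine Continuous.aestronglyMeasurable ?_
      unfold dotProduct
      fun_prop
    · refine Filter.Eventually.of_forall fun x => ?_
      rw [show 2 * (Real.pi : ℂ) * Complex.I * ((toRealVec m ⬝ᵥ x : ℝ) : ℂ) =
        ((2 * Real.pi * (toRealVec m ⬝ᵥ x) : ℝ) : ℂ) * Complex.I by push_cast; ring]
      rw [Complex.norm_exp_ofReal_mul_I]
  have hre := integral_re (𝕜 := ℂ) hint
  rw [hzero] at hre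
  simp only [RCLike.re_to_complex, Complex.zero_re] at hre
  rw [← hre]
  refine integral_congr_ae (Filter.Eventually.of_forall fun x => ?_)
  simp only
  rw [show 2 * (Real.pi : ℂ) * Complex.I * ((toRealVec m ⬝ᵥ x : ℝ) : ℂ) =
    ((2 * Real.pi * (toRealVec m ⬝ᵥ x) : ℝ) : ℂ) * Complex.I by push_cast; ring]
  rw [Complex.exp_ofReal_mul_I_re]

/-- The squared modulus of the exponential sum with frequencies in `A`. -/
noncomputable def expSumSq (A : Finset (ι → ℤ)) (x : ι → ℝ) : ℝ :=
  ∑ w ∈ A, ∑ w' ∈ A, Real.cos (2 * Real.pi * (toRealVec (w - w') ⬝ᵥ x))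

lemma expSumSq_nonneg (A : Finset (ι → ℤ)) (x : ι → ℝ) : 0 ≤ expSumSq A x := by
  have : expSumSq A x = (∑ w ∈ A, Real.cos (2 * Real.pi * (toRealVec w ⬝ᵥ x))) ^ 2 +
      (∑ w ∈ A, Real.sin (2 * Real.pi * (toRealVec w ⬝ᵥ x))) ^ 2 := by
    rw [sq, sq, Finset.sum_mul_sum, Finset.sum_mul_sum, ← Finset.sum_add_distrib]
    unfold expSumSq
    refine Finset.sum_congr rfl fun w _ => ?_
    rw [← Finset.sum_add_distrib]
    refine Finset.sum_congr rfl fun w' _ => ?_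
    rw [toRealVec_sub, sub_dotProduct, mul_sub, Real.cos_sub]
  rw [this]; positivity

lemma continuous_expSumSq (A : Finset (ι → ℤ)) : Continuous (expSumSq A) := by
  unfold expSumSq dotProduct
  fun_prop

lemma expSumSq_add_int (A : Finset (ι → ℤ)) (x : ι → ℝ) (a : ι → ℤ) :
    expSumSq A (x + toRealVec a) = expSumSq A x := by
  unfold expSumSq
  refine Finset.sum_congr rfl fun w _ => Finset.sum_congr rfl fun w' _ => ?_
  have : toRealVec (w - w') ⬝ᵥ toRealVec a = (((w - w') ⬝ᵥ a : ℤ) : ℝ) := by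
    simp [dotProduct, toRealVec]
  rw [dotProduct_add, this, mul_add,
    show 2 * Real.pi * (((w - w') ⬝ᵥ a : ℤ) : ℝ) = (((w - w') ⬝ᵥ a : ℤ) : ℝ) * (2 * Real.pi) by ring,
    Real.cos_add_int_mul_two_pi]

lemma volume_unitCube : volume (Set.univ.pi (fun _ : ι => Set.Ioc (0 : ℝ) 1)) = 1 := by
  rw [Real.volume_pi_Ioc]; simp

lemma lintegral_expSumSq (A : Finset (ι → ℤ)) :
    ∫⁻ x in Set.univ.pi (fun _ : ι => Set.Ioc (0 : ℝ) 1), ENNReal.ofReal (expSumSq A x) = A.card := by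
  classical
  have hfin : IsFiniteMeasure
      (volume.restrict (Set.univ.pi (fun _ : ι => Set.Ioc (0 : ℝ) 1))) :=
    ⟨by rw [Measure.restrict_apply_univ, volume_unitCube]; simp⟩
  have hcos : ∀ m : ι → ℤ, Integrable (fun x => Real.cos (2 * Real.pi * (toRealVec m ⬝ᵥ x)))
      (volume.restrict (Set.univ.pi (fun _ : ι => Set.Ioc (0 : ℝ) 1))) := by
    intro m
    refine Integrable.of_bound (C := 1) ?_ ?_
    · refine Continuous.aestronglyMeasurable ?_
      unfold dotProduct
      fun_prop
    · exact Filter.Eventually.of_forall fun x => Real.abs_cos_le_one _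
  rw [← ofReal_integral_eq_lintegral_ofReal]
  · have : ∫ x in Set.univ.pi (fun _ : ι => Set.Ioc (0 : ℝ) 1), expSumSq A x = A.card := by
      unfold expSumSq
      rw [integral_finsetSum _ fun w _ => integrable_finsetSum _ fun w' _ => hcos _]
      have : ∀ w ∈ A, ∫ x in Set.univ.pi (fun _ : ι => Set.Ioc (0 : ℝ) 1), ∑ w' ∈ A,
          Real.cos (2 * Real.pi * (toRealVec (w - w') ⬝ᵥ x)) = 1 := by
        intro w hw
        rw [integral_finsetSum _ fun w' _ => hcos _, Finset.sum_eq_single w]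
        · have h0 : toRealVec (0 : ι → ℤ) = 0 := by ext; simp [toRealVec]
          simp [h0, Measure.real, volume_unitCube]
        · intro w' _ hne
          exact integral_cos_dotProduct_unitCube _ (sub_ne_zero.mpr hne.symm)
        · exact fun h => absurd hw h
      rw [Finset.sum_congr rfl this]; simp
    rw [this]; simp
  · exact integrable_finsetSum _ fun w _ => integrable_finsetSum _ fun w' _ => hcos _
  · exact Filter.Eventually.of_forall fun x => expSumSq_nonneg A x

/-- Lattice duality: if all differences of points of `A` are almost orthogonal to `D`, and `B`
contains all integer differences of points of `D`, then `|A| vol(D) ≤ 2 |B|`. -/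
lemma card_mul_volume_le (A B : Finset (ι → ℤ)) (D : Set (ι → ℝ)) (hD : MeasurableSet D)
    (hAD : ∀ x ∈ D, ∀ w ∈ A, ∀ w' ∈ A, |toRealVec (w - w') ⬝ᵥ x| ≤ 1 / 6)
    (hB : ∀ x ∈ D, ∀ a : ι → ℤ, x + toRealVec a ∈ D → a ∈ B) :
    (A.card : ENNReal) * volume D ≤ 2 * B.card := by
  classical
  rcases A.eq_empty_or_nonempty with rfl | hA
  · simp
  have hAc : (A.card : ENNReal) ≠ 0 := by simpa using hA.ne_empty
  set U : Set (ι → ℝ) := Set.univ.pi (fun _ : ι => Set.Ioc (0 : ℝ) 1) with hU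
  have hUm : MeasurableSet U := MeasurableSet.univ_pi fun _ => measurableSet_Ioc
  have hlow : (A.card : ENNReal) * (A.card * volume D) ≤
      2 * ∫⁻ x in D, ENNReal.ofReal (expSumSq A x) := by
    have : ∀ x ∈ D, ENNReal.ofReal ((A.card : ℝ) * A.card / 2) ≤ ENNReal.ofReal (expSumSq A x) := by
      intro x hx
      refine ENNReal.ofReal_le_ofReal ?_
      have : ∀ w ∈ A, ∀ w' ∈ A, (1 / 2 : ℝ) ≤
          Real.cos (2 * Real.pi * (toRealVec (w - w') ⬝ᵥ x)) := by
        intro w hw w' hw'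
        have h := hAD x hx w hw w' hw'
        rw [← Real.cos_abs, ← Real.cos_pi_div_three]
        refine Real.cos_le_cos_of_nonneg_of_le_pi (abs_nonneg _) (by linarith [Real.pi_pos]) ?_
        rw [abs_mul, abs_of_pos (by positivity : 0 < 2 * Real.pi)]
        nlinarith [Real.pi_pos]
      calc (A.card : ℝ) * A.card / 2 = ∑ w ∈ A, ∑ w' ∈ A, (1 / 2 : ℝ) := by
            simp [Finset.sum_const]; ring
        _ ≤ _ := Finset.sum_le_sum fun w hw => Finset.sum_le_sum fun w' hw' => this w hw w' hw'
    have h2 := setLIntegral_mono' (μ := volume) hD this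
    rw [setLIntegral_const] at h2
    calc (A.card : ENNReal) * (A.card * volume D)
        = 2 * (ENNReal.ofReal ((A.card : ℝ) * A.card / 2) * volume D) := by
          rw [← mul_assoc, ← mul_assoc]
          congr 1
          rw [show (2 : ENNReal) = ENNReal.ofReal 2 by simp, ← ENNReal.ofReal_mul (by norm_num),
            mul_div_cancel₀ _ (by norm_num : (2 : ℝ) ≠ 0), ENNReal.ofReal_mul (by positivity)]
          simp
      _ ≤ _ := by gcongr
  have hup : ∫⁻ x in D, ENNReal.ofReal (expSumSq A x) ≤ B.card * A.card := by
    have hcov : D = ⋃ a : ι → ℤ, D ∩ ((fun x => x + toRealVec (-a)) ⁻¹' U) := by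
      ext x
      simp only [Set.mem_iUnion, Set.mem_inter_iff, exists_and_left, iff_self_and]
      intro _
      refine ⟨fun i => ⌈x i⌉ - 1, ?_⟩
      intro i _
      simp only [toRealVec, Pi.add_apply, Pi.neg_apply, Int.cast_neg, Int.cast_sub, Int.cast_one,
        Set.mem_Ioc]
      constructor <;> linarith [Int.le_ceil (x i), Int.ceil_lt_add_one (x i)]
    have hdisj : Pairwise (Function.onFun Disjoint
        fun a : ι → ℤ => D ∩ ((fun x => x + toRealVec (-a)) ⁻¹' U)) := by
      intro a b hab
      refine Set.disjoint_left.mpr fun x hxa hxb => hab ?_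
      ext i
      have h1 := hxa.2 i trivial
      have h2 := hxb.2 i trivial
      simp only [toRealVec, Pi.add_apply, Pi.neg_apply, Int.cast_neg, Set.mem_Ioc] at h1 h2
      have h3 : (a i : ℝ) < b i + 1 := by linarith
      have h4 : (b i : ℝ) < a i + 1 := by linarith
      norm_cast at h3 h4
      omega
    have hmeas : ∀ a : ι → ℤ, MeasurableSet (D ∩ ((fun x => x + toRealVec (-a)) ⁻¹' U)) :=
      fun a => hD.inter (hUm.preimage (by fun_prop))
    have hpiece : ∀ a : ι → ℤ, ∫⁻ x in D ∩ ((fun x => x + toRealVec (-a)) ⁻¹' U),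
        ENNReal.ofReal (expSumSq A x) = ∫⁻ x in U,
          D.indicator 1 (x + toRealVec a) * ENNReal.ofReal (expSumSq A x) := by
      intro a
      rw [← lintegral_indicator (hmeas a), ← lintegral_indicator hUm,
        ← lintegral_add_right_eq_self _ (toRealVec a)]
      refine lintegral_congr fun x => ?_
      have hx : x + toRealVec a + toRealVec (-a) = x := by
        ext i; simp [toRealVec]
      by_cases h1 : x ∈ U <;> by_cases h2 : x + toRealVec a ∈ D <;>
        simp [Set.indicator, h1, h2, hx, expSumSq_add_int]
    have hFm : Measurable fun x => ENNReal.ofReal (expSumSq A x) :=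
      (continuous_expSumSq A).measurable.ennreal_ofReal
    rw [hcov, lintegral_iUnion hmeas hdisj]
    simp_rw [hpiece]
    rw [← lintegral_tsum]
    · calc ∫⁻ x in U, ∑' a : ι → ℤ, D.indicator 1 (x + toRealVec a) * ENNReal.ofReal (expSumSq A x)
          ≤ ∫⁻ x in U, B.card * ENNReal.ofReal (expSumSq A x) := by
            refine lintegral_mono fun x => ?_
            dsimp only
            rw [ENNReal.tsum_mul_right]
            gcongr
            by_cases hex : ∃ a₀ : ι → ℤ, x + toRealVec a₀ ∈ D
            · obtain ⟨a₀, ha₀⟩ := hex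
              have hsub : ∀ a : ι → ℤ, x + toRealVec a ∈ D → a - a₀ ∈ B := by
                intro a ha
                refine hB _ ha₀ _ ?_
                rw [toRealVec_sub]
                simpa using ha
              calc ∑' a : ι → ℤ, D.indicator (1 : (ι → ℝ) → ENNReal) (x + toRealVec a)
                  ≤ ∑' a : ι → ℤ, (B : Set (ι → ℤ)).indicator 1 (a - a₀) := by
                    refine ENNReal.tsum_le_tsum fun a => ?_
                    by_cases h : x + toRealVec a ∈ D
                    · simp [h, hsub a h]
                    · simp [h]
                _ = ∑' a : ι → ℤ, (B : Set (ι → ℤ)).indicator 1 a :=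
                    (Equiv.subRight a₀).tsum_eq
                      (fun a => (B : Set (ι → ℤ)).indicator (1 : (ι → ℤ) → ENNReal) a)
                _ = B.card := by
                    rw [tsum_eq_sum (s := B)]
                    · rw [Finset.sum_congr rfl (g := fun _ => 1)]
                      · simp
                      · intro a ha; simp [ha]
                    · intro a ha; simp [ha]
            · push Not at hex
              simp [hex]
        _ = B.card * A.card := by
            rw [lintegral_const_mul _ hFm, lintegral_expSumSq]
    · intro a
      exact (((measurable_one.indicator hD).comp (measurable_add_const _)).mul hFm).aemeasurable
  have hfinal : (A.card : ENNReal) * (A.card * volume D) ≤ A.card * (2 * B.card) := by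
    calc _ ≤ _ := hlow
      _ ≤ 2 * (B.card * A.card) := by gcongr
      _ = _ := by ring
  exact (ENNReal.mul_le_mul_iff_right hAc (by simp)).mp hfinal

end LatticeDuality

section Transference

variable {ι : Type} [Fintype ι]

lemma abs_dotProduct_le (u v : ι → ℝ) : |u ⬝ᵥ v| ≤ Fintype.card ι * ‖u‖ * ‖v‖ := by
  calc |u ⬝ᵥ v| ≤ ∑ i, |u i * v i| := Finset.abs_sum_le_sum_abs _ _
    _ ≤ ∑ _i : ι, ‖u‖ * ‖v‖ := by
        refine Finset.sum_le_sum fun i _ => ?_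
        rw [abs_mul]
        exact mul_le_mul (norm_le_pi_norm u i) (norm_le_pi_norm v i) (abs_nonneg _) (norm_nonneg _)
    _ = _ := by simp [mul_assoc]

lemma norm_toRealVec_le_iff [DecidableEq ι] (w : ι → ℤ) {R : ℝ} (hR : 0 ≤ R) :
    ‖toRealVec w‖ ≤ R ↔ w ∈ Fintype.piFinset fun _ : ι => Finset.Icc (-⌊R⌋) ⌊R⌋ := by
  rw [pi_norm_le_iff_of_nonneg hR]
  simp only [toRealVec, Real.norm_eq_abs, Fintype.mem_piFinset, Finset.mem_Icc]
  refine forall_congr' fun i => ?_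
  rw [abs_le, Int.le_floor, neg_le, neg_le (a := ⌊R⌋), Int.le_floor]
  push_cast
  rfl

lemma finite_norm_toRealVec_le (R : ℝ) : {w : ι → ℤ | ‖toRealVec w‖ ≤ R}.Finite := by
  classical
  rcases lt_or_ge R 0 with h | h
  · convert Set.finite_empty
    ext w
    simp only [Set.mem_ofPred_eq, Set.mem_empty_iff_false, iff_false, not_le]
    exact h.trans_le (norm_nonneg _)
  · refine (Fintype.piFinset fun _ : ι => Finset.Icc (-⌊R⌋) ⌊R⌋).finite_toSet.subset fun w hw => ?_
    exact (norm_toRealVec_le_iff w h).1 hw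

lemma ncard_norm_toRealVec_le {R : ℝ} (hR : 0 ≤ R) :
    ({w : ι → ℤ | ‖toRealVec w‖ ≤ R}.ncard : ℝ) ≤ (2 * R + 1) ^ Fintype.card ι := by
  classical
  have : {w : ι → ℤ | ‖toRealVec w‖ ≤ R} =
      (Fintype.piFinset fun _ : ι => Finset.Icc (-⌊R⌋) ⌊R⌋ : Set (ι → ℤ)) := by
    ext w; exact norm_toRealVec_le_iff w hR
  rw [this, Set.ncard_coe_finset, Fintype.card_piFinset]
  simp only [Int.card_Icc, Finset.prod_const, Finset.card_univ, Nat.cast_pow]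
  refine pow_le_pow_left₀ (by positivity) ?_ _
  have h0 : 0 ≤ ⌊R⌋ := Int.floor_nonneg.mpr hR
  have : (((⌊R⌋ + 1 - -⌊R⌋).toNat : ℤ) : ℝ) = 2 * ⌊R⌋ + 1 := by
    rw [Int.toNat_of_nonneg (by omega)]; push_cast; ring
  rw [Int.cast_natCast] at this
  rw [this]
  linarith [Int.floor_le R]

/-- Integer vectors close to the line through `x` and to the hyperplane orthogonal to `y`; the
functional `l` measures the position along the line. -/
def localSet (x y l : ι → ℝ) (Q σ δ : ℝ) : Set (ι → ℤ) :=
  {w | |l ⬝ᵥ toRealVec w| ≤ Q ∧ ‖toRealVec w - (l ⬝ᵥ toRealVec w) • x‖ ≤ σ ∧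
    |y ⬝ᵥ toRealVec w| ≤ δ}

lemma norm_le_of_mem_localSet {x y l : ι → ℝ} {Q σ δ : ℝ} {w : ι → ℤ}
    (hw : w ∈ localSet x y l Q σ δ) : ‖toRealVec w‖ ≤ |l ⬝ᵥ toRealVec w| * ‖x‖ + σ := by
  have h := norm_add_le ((l ⬝ᵥ toRealVec w) • x) (toRealVec w - (l ⬝ᵥ toRealVec w) • x)
  rw [add_sub_cancel, norm_smul, Real.norm_eq_abs] at h
  linarith [hw.2.1]

lemma finite_localSet (x y l : ι → ℝ) (Q σ δ : ℝ) : (localSet x y l Q σ δ).Finite := by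
  refine (finite_norm_toRealVec_le (Q * ‖x‖ + σ)).subset fun w hw => ?_
  exact (norm_le_of_mem_localSet hw).trans
    (by have := mul_le_mul_of_nonneg_right hw.1 (norm_nonneg x); linarith)

set_option maxHeartbeats 1000000 in
/-- Transference: the number of lattice points in a local body is bounded by its volume times the
number of lattice points in the polar body. -/
lemma ncard_localSet_le [Nonempty ι] {C : ℝ} (hC : 1 ≤ C) : ∃ K > 0, ∀ x y l m : ι → ℝ,
    ‖x‖ ≤ C → ‖y‖ ≤ C → ‖l‖ ≤ C → ‖m‖ ≤ C → l ⬝ᵥ x = 1 → m ⬝ᵥ y = 1 → m ⬝ᵥ l = 0 → x ⬝ᵥ y = 0 →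
    ∀ Q δ : ℝ, 0 < δ → δ ≤ Q → ((localSet x y l Q √(δ * Q) δ).ncard : ℝ) ≤
      K * √(δ * Q) ^ Fintype.card ι *
        (localSet y x m (1 / δ) (1 / √(δ * Q)) (1 / Q)).ncard := by
  classical
  set N : ℝ := (Fintype.card ι : ℝ) with hN
  have hN1 : 1 ≤ N := by
    rw [hN]; exact_mod_cast Fintype.card_pos
  have hC0 : 0 < C := by linarith
  have hNC : 1 ≤ N * C := one_le_mul_of_one_le_of_one_le hN1 hC
  set c : ℝ := 1 / (60 * (N * C) ^ 2) with hc
  have hcpos : 0 < c := by positivity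
  have hcNC : (N * C) ^ 2 * c = 1 / 60 := by rw [hc]; field_simp
  have hcNC1 : (N * C) * c ≤ 1 / 60 := by rw [← hcNC]; gcongr; nlinarith
  have hc1 : c ≤ 1 / 60 := by nlinarith
  have hcNC2 : N * C ^ 2 * c ≤ 1 / 60 := by
    rw [← hcNC]; gcongr; nlinarith [sq_nonneg C]
  refine ⟨2 / (2 * c) ^ Fintype.card ι, by positivity, ?_⟩
  intro x y l m hx hy hl hm hlx hmy hml hxy Q δ hδ hδQ
  have hQ : 0 < Q := by linarith
  set σ := √(δ * Q) with hσ
  have hσ0 : 0 < σ := Real.sqrt_pos.mpr (by positivity)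
  have hσ2 : σ * σ = δ * Q := Real.mul_self_sqrt (by positivity)
  have hσQ : σ ≤ Q := by
    by_contra! h
    nlinarith
  set T : (ι → ℝ) →ₗ[ℝ] (ι → ℝ) := Matrix.mulVecLin
    ((1 + Matrix.replicateCol Unit ((σ / δ - 1) • y) * Matrix.replicateRow Unit m) *
      (1 + Matrix.replicateCol Unit ((σ / Q - 1) • l) * Matrix.replicateRow Unit x)) with hT
  have hrank : ∀ u v a : ι → ℝ,
      (1 + Matrix.replicateCol Unit u * Matrix.replicateRow Unit v).mulVec a = a + (v ⬝ᵥ a) • u := by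
    intro u v a
    rw [Matrix.add_mulVec, Matrix.one_mulVec]
    congr 1
    ext i
    simp [Matrix.mulVec, Matrix.mul_apply, dotProduct, Finset.mul_sum, mul_comm, mul_left_comm]
  have hTa : ∀ a, T a = a + ((σ / Q - 1) * (x ⬝ᵥ a)) • l + ((σ / δ - 1) * (m ⬝ᵥ a)) • y := by
    intro a
    rw [hT, Matrix.mulVecLin_apply, ← Matrix.mulVec_mulVec, hrank, hrank]
    simp only [dotProduct_add, dotProduct_smul, hml, smul_smul, smul_eq_mul, mul_zero, add_zero]
    rw [mul_comm (x ⬝ᵥ a), mul_comm (m ⬝ᵥ a)]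
  have hdet : LinearMap.det T = 1 := by
    rw [hT, ← Matrix.toLin'_apply', LinearMap.det_toLin', Matrix.det_mul,
      Matrix.det_one_add_replicateCol_mul_replicateRow,
      Matrix.det_one_add_replicateCol_mul_replicateRow, dotProduct_smul, dotProduct_smul, hmy,
      dotProduct_comm x l, hlx]
    simp only [smul_eq_mul, mul_one, add_sub_cancel]
    field_simp
    linarith
  have hmT : ∀ a, m ⬝ᵥ T a = σ / δ * (m ⬝ᵥ a) := by
    intro a
    rw [hTa]
    simp only [dotProduct_add, dotProduct_smul, hml, hmy, smul_eq_mul]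
    ring
  have hxT : ∀ a, x ⬝ᵥ T a = σ / Q * (x ⬝ᵥ a) := by
    intro a
    rw [hTa]
    simp only [dotProduct_add, dotProduct_smul, hxy, dotProduct_comm x l, hlx, smul_eq_mul]
    ring
  have hbound : ∀ a, ∀ k : ℝ, ‖a‖ ≤ k * (c / σ) → |m ⬝ᵥ T a| ≤ k * (N * C * c) / δ ∧
      ‖T a - (m ⬝ᵥ T a) • y‖ ≤ k * (c + 2 * (N * C ^ 2 * c)) / σ ∧
      |x ⬝ᵥ T a| ≤ k * (N * C * c) / Q := by
    intro a k ha
    have hma : |m ⬝ᵥ a| ≤ N * C * (k * (c / σ)) := (abs_dotProduct_le m a).trans (by gcongr)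
    have hxa : |x ⬝ᵥ a| ≤ N * C * (k * (c / σ)) := (abs_dotProduct_le x a).trans (by gcongr)
    refine ⟨?_, ?_, ?_⟩
    · rw [hmT, abs_mul, abs_of_pos (by positivity : 0 < σ / δ)]
      calc σ / δ * |m ⬝ᵥ a| ≤ σ / δ * (N * C * (k * (c / σ))) := by gcongr
        _ = _ := by field_simp
    · have : T a - (m ⬝ᵥ T a) • y = a + ((σ / Q - 1) * (x ⬝ᵥ a)) • l - (m ⬝ᵥ a) • y := by
        rw [hmT, hTa, add_sub_assoc, ← sub_smul, show (σ / δ - 1) * (m ⬝ᵥ a) - σ / δ * (m ⬝ᵥ a) =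
          -(m ⬝ᵥ a) by ring, neg_smul, ← sub_eq_add_neg]
      rw [this]
      have h1 : |σ / Q - 1| ≤ 1 := by
        rw [abs_le]
        have h2 : 0 < σ / Q := by positivity
        have h3 : σ / Q ≤ 1 := by rw [div_le_one hQ]; exact hσQ
        constructor <;> linarith
      calc ‖a + ((σ / Q - 1) * (x ⬝ᵥ a)) • l - (m ⬝ᵥ a) • y‖
          ≤ ‖a‖ + |σ / Q - 1| * |x ⬝ᵥ a| * ‖l‖ + |m ⬝ᵥ a| * ‖y‖ := by
            refine (norm_sub_le _ _).trans ?_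
            rw [norm_smul (m ⬝ᵥ a), Real.norm_eq_abs]
            gcongr
            refine (norm_add_le _ _).trans ?_
            rw [norm_smul, Real.norm_eq_abs, abs_mul]
        _ ≤ k * (c / σ) + 1 * (N * C * (k * (c / σ))) * C + (N * C * (k * (c / σ))) * C := by
            have : 0 ≤ N * C * (k * (c / σ)) := (abs_nonneg _).trans hma
            gcongr
        _ = _ := by field_simp; ring
    · rw [hxT, abs_mul, abs_of_pos (by positivity : 0 < σ / Q)]
      calc σ / Q * |x ⬝ᵥ a| ≤ σ / Q * (N * C * (k * (c / σ))) := by gcongr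
        _ = _ := by field_simp
  set A := (finite_localSet x y l Q σ δ).toFinset with hA
  set B := (finite_localSet y x m (1 / δ) (1 / σ) (1 / Q)).toFinset with hB
  set D : Set (ι → ℝ) := T '' Metric.closedBall 0 (c / σ) with hD
  have hDm : MeasurableSet D :=
    ((isCompact_closedBall _ _).image T.continuous_of_finiteDimensional).measurableSet
  have hAD : ∀ z ∈ D, ∀ w ∈ A, |toRealVec w ⬝ᵥ z| ≤ 1 / 12 := by
    rintro z ⟨a, ha, rfl⟩ w hw
    rw [hA, Set.Finite.mem_toFinset] at hw
    obtain ⟨h1, h2, h3⟩ := hbound a 1 (by simpa using ha)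
    obtain ⟨w1, w2, w3⟩ := hw
    set z := T a
    set q := l ⬝ᵥ toRealVec w with hq
    have hdec : toRealVec w ⬝ᵥ z = q * (x ⬝ᵥ z) + (m ⬝ᵥ z) * (y ⬝ᵥ toRealVec w) +
        (toRealVec w - q • x) ⬝ᵥ (z - (m ⬝ᵥ z) • y) := by
      simp only [sub_dotProduct, dotProduct_sub, smul_dotProduct, dotProduct_smul, smul_eq_mul, hxy,
        dotProduct_comm (toRealVec w) y]
      ring
    rw [hdec]
    have e1 : |q * (x ⬝ᵥ z)| ≤ Q * (1 * (N * C * c) / Q) := by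
      rw [abs_mul]; gcongr
    have e2 : |(m ⬝ᵥ z) * (y ⬝ᵥ toRealVec w)| ≤ (1 * (N * C * c) / δ) * δ := by
      rw [abs_mul]; gcongr
    have e3 : |(toRealVec w - q • x) ⬝ᵥ (z - (m ⬝ᵥ z) • y)| ≤
        N * σ * (1 * (c + 2 * (N * C ^ 2 * c)) / σ) :=
      (abs_dotProduct_le _ _).trans (by gcongr)
    have e1' : Q * (1 * (N * C * c) / Q) = N * C * c := by field_simp
    have e2' : (1 * (N * C * c) / δ) * δ = N * C * c := by field_simp
    have e3' : N * σ * (1 * (c + 2 * (N * C ^ 2 * c)) / σ) = N * c + 2 * ((N * C) ^ 2 * c) := by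
      field_simp
    have e4 : N * c ≤ N * C * c := by gcongr; exact le_mul_of_one_le_right (by linarith) hC
    have e5 := (abs_add_three (q * (x ⬝ᵥ z)) ((m ⬝ᵥ z) * (y ⬝ᵥ toRealVec w))
      ((toRealVec w - q • x) ⬝ᵥ (z - (m ⬝ᵥ z) • y))).trans (add_le_add (add_le_add e1 e2) e3)
    rw [e1', e2', e3'] at e5
    exact e5.trans (by linarith only [hcNC1, e4, hcNC])
  have hmain := card_mul_volume_le A B D hDm ?_ ?_
  · have hvol : volume D = ENNReal.ofReal ((2 * (c / σ)) ^ Fintype.card ι) := by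
      rw [hD, Measure.addHaar_image_linearMap, hdet, Real.volume_pi_closedBall _ (by positivity)]
      simp
    rw [hvol, ← ENNReal.ofReal_natCast, ← ENNReal.ofReal_natCast, ← ENNReal.ofReal_mul (by positivity),
      show (2 : ENNReal) = ENNReal.ofReal 2 by simp, ← ENNReal.ofReal_mul (by norm_num),
      ENNReal.ofReal_le_ofReal_iff (by positivity)] at hmain
    rw [Set.ncard_eq_toFinset_card _ (finite_localSet x y l Q σ δ),
      Set.ncard_eq_toFinset_card _ (finite_localSet y x m (1 / δ) (1 / σ) (1 / Q))]
    rw [show 2 * (c / σ) = 2 * c / σ by ring, div_pow, mul_div_assoc', div_le_iff₀ (by positivity)]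
      at hmain
    rw [div_mul_eq_mul_div, div_mul_eq_mul_div, le_div_iff₀ (by positivity)]
    linarith
  · intro z hz w hw w' hw'
    rw [toRealVec_sub, sub_dotProduct]
    have h1 := abs_le.mp (hAD z hz w hw)
    have h2 := abs_le.mp (hAD z hz w' hw')
    rw [abs_le]
    constructor <;> linarith [h1.1, h1.2, h2.1, h2.2]
  · rintro z ⟨a, ha, rfl⟩ b ⟨a', ha', hb⟩
    have hb' : toRealVec b = T (a' - a) := by
      rw [map_sub, hb]; simp
    have haa : ‖a' - a‖ ≤ 2 * (c / σ) := by
      rw [mem_closedBall_zero_iff] at ha ha'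
      exact (norm_sub_le _ _).trans (by linarith)
    obtain ⟨h1, h2, h3⟩ := hbound _ 2 haa
    rw [hB, Set.Finite.mem_toFinset]
    rw [← hb'] at h1 h2 h3
    exact ⟨h1.trans (by gcongr; linarith), h2.trans (by gcongr; linarith),
      h3.trans (by gcongr; linarith)⟩

end Transference

section DualPairs

variable {ι : Type} [Fintype ι] {d : ℕ}

/-- A patch of a hypersurface and its projective dual, parametrised by a bounded set `E ⊆ ℝ^d`:
`X t` is a point and `Y t` its tangent hyperplane in homogeneous coordinates, normalised by the
functionals `l` and `m`. The lower Lipschitz bounds encode nonvanishing curvature. -/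
structure IsDualPair (C : ℝ) (E : Set (Fin d → ℝ)) (X Y : (Fin d → ℝ) → ι → ℝ) (l m : ι → ℝ) :
    Prop where
  one_le : 1 ≤ C
  bdd : ∀ t ∈ E, ‖t‖ ≤ C
  norm_l : ‖l‖ ≤ C
  norm_m : ‖m‖ ≤ C
  m_l : m ⬝ᵥ l = 0
  l_X : ∀ t ∈ E, l ⬝ᵥ X t = 1
  m_Y : ∀ t ∈ E, m ⬝ᵥ Y t = 1
  norm_X : ∀ t ∈ E, ‖X t‖ ≤ C
  norm_Y : ∀ t ∈ E, ‖Y t‖ ≤ C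
  X_le : ∀ t ∈ E, ∀ t' ∈ E, ‖X t - X t'‖ ≤ C * ‖t - t'‖
  Y_le : ∀ t ∈ E, ∀ t' ∈ E, ‖Y t - Y t'‖ ≤ C * ‖t - t'‖
  le_X : ∀ t ∈ E, ∀ t' ∈ E, ‖t - t'‖ ≤ C * ‖X t - X t'‖
  le_Y : ∀ t ∈ E, ∀ t' ∈ E, ‖t - t'‖ ≤ C * ‖Y t - Y t'‖
  Y_X : ∀ t ∈ E, ∀ t' ∈ E, |Y t ⬝ᵥ X t'| ≤ C * ‖t - t'‖ ^ 2

namespace IsDualPair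

variable {C : ℝ} {E : Set (Fin d → ℝ)} {X Y : (Fin d → ℝ) → ι → ℝ} {l m : ι → ℝ}

lemma symm (h : IsDualPair C E X Y l m) : IsDualPair C E Y X m l where
  one_le := h.one_le
  bdd := h.bdd
  norm_l := h.norm_m
  norm_m := h.norm_l
  m_l := by rw [dotProduct_comm]; exact h.m_l
  l_X := h.m_Y
  m_Y := h.l_X
  norm_X := h.norm_Y
  norm_Y := h.norm_X
  X_le := h.Y_le
  Y_le := h.X_le
  le_X := h.le_Y
  le_Y := h.le_X
  Y_X := fun t ht t' ht' => by
    rw [dotProduct_comm, norm_sub_rev]; exact h.Y_X t' ht' t ht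

lemma Y_X_self (h : IsDualPair C E X Y l m) {t : Fin d → ℝ} (ht : t ∈ E) : Y t ⬝ᵥ X t = 0 := by
  have := h.Y_X t ht t ht
  simpa using this

end IsDualPair

/-- Integer vectors close to the cone over the patch `X '' E`. -/
def nearSet (E : Set (Fin d → ℝ)) (X Y : (Fin d → ℝ) → ι → ℝ) (l : ι → ℝ) (Q δ : ℝ) :
    Set (ι → ℤ) :=
  {w | ∃ t ∈ E, w ∈ localSet (X t) (Y t) l Q √(δ * Q) δ}

lemma localSet_mono {x y l : ι → ℝ} {Q σ δ Q' σ' δ' : ℝ} (hQ : Q ≤ Q') (hσ : σ ≤ σ')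
    (hδ : δ ≤ δ') : localSet x y l Q σ δ ⊆ localSet x y l Q' σ' δ' :=
  fun _ hw => ⟨hw.1.trans hQ, hw.2.1.trans hσ, hw.2.2.trans hδ⟩

variable {C : ℝ} {E : Set (Fin d → ℝ)} {X Y : (Fin d → ℝ) → ι → ℝ} {l m : ι → ℝ}

lemma nearSet_mono {Q δ δ' : ℝ} (hQ : 0 ≤ Q) (hδ : δ ≤ δ') :
    nearSet E X Y l Q δ ⊆ nearSet E X Y l Q δ' :=
  fun _ ⟨t, ht, hw⟩ => ⟨t, ht, localSet_mono le_rfl (Real.sqrt_le_sqrt (by gcongr)) hδ hw⟩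

lemma nearSet_subset (h : IsDualPair C E X Y l m) {Q δ : ℝ} :
    nearSet E X Y l Q δ ⊆ {w | ‖toRealVec w‖ ≤ Q * C + √(δ * Q)} := by
  rintro w ⟨t, ht, hw⟩
  have hQ : 0 ≤ Q := (abs_nonneg _).trans hw.1
  refine (norm_le_of_mem_localSet hw).trans ?_
  gcongr
  · exact hw.1
  · exact h.norm_X t ht

lemma finite_nearSet (h : IsDualPair C E X Y l m) (Q δ : ℝ) : (nearSet E X Y l Q δ).Finite :=
  (finite_norm_toRealVec_le _).subset (nearSet_subset h)

lemma mem_localSet_of_near (h : IsDualPair C E X Y l m) {t t₀ : Fin d → ℝ} (ht : t ∈ E)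
    (ht₀ : t₀ ∈ E) {Q σ δ r : ℝ} (hr : ‖t - t₀‖ ≤ r) (hrQ : r * Q = σ) (hrσ : r * σ = δ)
    {w : ι → ℤ} (hw : w ∈ localSet (X t) (Y t) l Q σ δ) :
    w ∈ localSet (X t₀) (Y t₀) l ((2 + C + Fintype.card ι * C) * Q)
      ((2 + C + Fintype.card ι * C) * σ) ((2 + C + Fintype.card ι * C) * δ) := by
  obtain ⟨h1, h2, h3⟩ := hw
  have hC := h.one_le
  have hQ : 0 ≤ Q := (abs_nonneg _).trans h1
  have hσ : 0 ≤ σ := (norm_nonneg _).trans h2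
  have hδ : 0 ≤ δ := (abs_nonneg _).trans h3
  have hr0 : 0 ≤ r := (norm_nonneg _).trans hr
  set N : ℝ := (Fintype.card ι : ℝ)
  have hN : 0 ≤ N := Nat.cast_nonneg _
  set q := l ⬝ᵥ toRealVec w
  have hX : ‖X t - X t₀‖ ≤ C * r := (h.X_le t ht t₀ ht₀).trans (by gcongr)
  have hY : ‖Y t₀ - Y t‖ ≤ C * r := (h.Y_le t₀ ht₀ t ht).trans (by rw [norm_sub_rev]; gcongr)
  have hNC : 0 ≤ N * C := by positivity
  refine ⟨h1.trans ?_, ?_, ?_⟩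
  · nlinarith
  · have : toRealVec w - q • X t₀ = (toRealVec w - q • X t) + q • (X t - X t₀) := by
      rw [smul_sub]; abel
    rw [this]
    calc _ ≤ ‖toRealVec w - q • X t‖ + |q| * ‖X t - X t₀‖ := by
          refine (norm_add_le _ _).trans ?_
          rw [norm_smul, Real.norm_eq_abs]
      _ ≤ σ + Q * (C * r) := by gcongr
      _ = (1 + C) * σ := by rw [← hrQ]; ring
      _ ≤ _ := mul_le_mul_of_nonneg_right (by linarith) hσ
  · have : Y t₀ ⬝ᵥ toRealVec w = (Y t₀ - Y t) ⬝ᵥ (toRealVec w - q • X t) + Y t ⬝ᵥ toRealVec w +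
        q * (Y t₀ ⬝ᵥ X t) := by
      simp only [sub_dotProduct, dotProduct_sub, dotProduct_smul, smul_eq_mul, h.Y_X_self ht]
      ring
    rw [this]
    calc _ ≤ |(Y t₀ - Y t) ⬝ᵥ (toRealVec w - q • X t)| + |Y t ⬝ᵥ toRealVec w| +
          |q| * |Y t₀ ⬝ᵥ X t| := by
          rw [← abs_mul]; exact abs_add_three _ _ _
      _ ≤ N * (C * r) * σ + δ + Q * (C * r ^ 2) := by
          gcongr
          · exact (abs_dotProduct_le _ _).trans (by gcongr)
          · refine (h.Y_X t₀ ht₀ t ht).trans ?_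
            rw [norm_sub_rev]; gcongr
      _ = (1 + C + N * C) * δ := by rw [← hrσ, ← hrQ]; ring
      _ ≤ _ := mul_le_mul_of_nonneg_right (by linarith) hδ

lemma norm_floor_sub_le {r R : ℝ} (hr : 0 < r) {t t' : Fin d → ℝ} (h : ‖t - t'‖ ≤ R) :
    ‖toRealVec ((fun i => ⌊t i / r⌋) - fun i => ⌊t' i / r⌋ : Fin d → ℤ)‖ ≤ R / r + 1 := by
  have hR : 0 ≤ R := (norm_nonneg _).trans h
  rw [pi_norm_le_iff_of_nonneg (by positivity)]
  intro i
  have h1 : |t i - t' i| ≤ R := (norm_le_pi_norm (t - t') i).trans h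
  have h2 : |t i / r - t' i / r| ≤ R / r := by
    rw [← sub_div, abs_div, abs_of_pos hr]; gcongr
  simp only [toRealVec, Pi.sub_apply, Int.cast_sub, Real.norm_eq_abs]
  rw [abs_le] at h2 ⊢
  constructor <;> linarith [Int.floor_le (t i / r), Int.lt_floor_add_one (t i / r),
    Int.floor_le (t' i / r), Int.lt_floor_add_one (t' i / r), h2.1, h2.2]

lemma eq_zero_of_norm_toRealVec_lt_one {w : ι → ℤ} (hw : ‖toRealVec w‖ < 1) : w = 0 := by
  ext i
  have : |(w i : ℝ)| < 1 := (norm_le_pi_norm (toRealVec w) i).trans_lt hw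
  rw [← Int.cast_abs] at this
  have h2 : |w i| < 1 := by exact_mod_cast this
  exact Int.abs_lt_one_iff.mp h2

lemma sum_card_filter_le {α β : Type*} (F : Finset α) (A : Finset β) (R : α → β → Prop)
    [∀ a b, Decidable (R a b)] (M : ℝ)
    (h : ∀ b ∈ A, ((F.filter fun a => R a b).card : ℝ) ≤ M) :
    ∑ a ∈ F, ((A.filter fun b => R a b).card : ℝ) ≤ A.card * M := by
  have := Finset.sum_card_bipartiteAbove_eq_sum_card_bipartiteBelow (s := F) (t := A) R
  unfold Finset.bipartiteAbove Finset.bipartiteBelow at this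
  have h2 : ∑ a ∈ F, ((A.filter fun b => R a b).card : ℝ) =
      ∑ b ∈ A, ((F.filter fun a => R a b).card : ℝ) := by exact_mod_cast this
  rw [h2, ← nsmul_eq_mul]
  exact Finset.sum_le_card_nsmul _ _ _ h

end DualPairs

section Bootstrap

variable {ι : Type} [Fintype ι] {d : ℕ}
variable {C : ℝ} {E : Set (Fin d → ℝ)} {X Y : (Fin d → ℝ) → ι → ℝ} {l m : ι → ℝ}

/-- A nonzero integer vector in a polar local body has height bounded below. -/
lemma le_height (h : IsDualPair C E X Y l m) {t : Fin d → ℝ} (ht : t ∈ E) {Q σ δ : ℝ} (hσ : σ ≤ 1 / 2)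
    {a : ι → ℤ} (ha : a ∈ localSet (X t) (Y t) l Q σ δ) (ha0 : a ≠ 0) :
    1 / (2 * C) ≤ |l ⬝ᵥ toRealVec a| := by
  by_contra! hlt
  have hC := h.one_le
  refine ha0 (eq_zero_of_norm_toRealVec_lt_one ((norm_le_of_mem_localSet ha).trans_lt ?_))
  have h1 : |l ⬝ᵥ toRealVec a| * ‖X t‖ ≤ |l ⬝ᵥ toRealVec a| * C := by
    gcongr; exact h.norm_X t ht
  have h2 : |l ⬝ᵥ toRealVec a| * C < 1 / (2 * C) * C := by gcongr
  have h3 : 1 / (2 * C) * C = 1 / 2 := by field_simp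
  linarith

/-- Parameters whose local bodies share a vector of large height are close. -/
lemma norm_sub_le_of_mem_localSet (h : IsDualPair C E X Y l m) {t t' : Fin d → ℝ} (ht : t ∈ E)
    (ht' : t' ∈ E) {Q σ δ : ℝ} {a : ι → ℤ} (ha : a ∈ localSet (X t) (Y t) l Q σ δ)
    (ha' : a ∈ localSet (X t') (Y t') l Q σ δ) (hpos : 0 < |l ⬝ᵥ toRealVec a|) :
    ‖t - t'‖ ≤ C * (2 * σ / |l ⬝ᵥ toRealVec a|) := by
  have hC := h.one_le
  refine (h.le_X t ht t' ht').trans ?_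
  gcongr
  rw [le_div_iff₀ hpos, mul_comm, ← Real.norm_eq_abs, ← norm_smul, smul_sub]
  have := norm_sub_le (toRealVec a - (l ⬝ᵥ toRealVec a) • X t')
    (toRealVec a - (l ⬝ᵥ toRealVec a) • X t)
  rw [sub_sub_sub_cancel_left] at this
  linarith [ha.2.1, ha'.2.1]

lemma sum_two_rpow_le {β : ℝ} (hβ : 0 < β) {δ : ℝ} (hδ : 0 < δ) (hδ1 : δ ≤ 1) :
    ∑ i ∈ Finset.range (Nat.log 2 ⌊1 / δ⌋₊ + 1), ((2 : ℝ) ^ i) ^ β ≤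
      2 ^ β / (2 ^ β - 1) * δ ^ (-β) := by
  have h1 : (1 : ℝ) < 2 ^ β := Real.one_lt_rpow (by norm_num) hβ
  have hpow : ∀ i : ℕ, ((2 : ℝ) ^ i) ^ β = (2 ^ β) ^ i := by
    intro i
    rw [← Real.rpow_natCast, ← Real.rpow_mul (by norm_num), mul_comm, Real.rpow_mul (by norm_num),
      Real.rpow_natCast]
  have hJ : ((2 : ℝ) ^ Nat.log 2 ⌊1 / δ⌋₊) ≤ 1 / δ := by
    have h2 : 1 ≤ ⌊1 / δ⌋₊ := Nat.le_floor (by rw [Nat.cast_one]; exact one_le_one_div hδ hδ1)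
    have h3 : ((2 ^ Nat.log 2 ⌊1 / δ⌋₊ : ℕ) : ℝ) ≤ ⌊1 / δ⌋₊ := by
      exact_mod_cast Nat.pow_log_le_self 2 (by omega)
    push_cast at h3
    exact h3.trans (Nat.floor_le (by positivity))
  simp_rw [hpow]
  rw [geom_sum_eq h1.ne', div_mul_eq_mul_div]
  refine div_le_div_of_nonneg_right ?_ (by linarith)
  · rw [pow_succ, ← hpow, mul_comm]
    have : ((2 : ℝ) ^ Nat.log 2 ⌊1 / δ⌋₊) ^ β ≤ δ ^ (-β) := by
      rw [Real.rpow_neg hδ.le, ← Real.inv_rpow hδ.le, ← one_div]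
      exact Real.rpow_le_rpow (by positivity) hJ hβ.le
    have h4 : (0 : ℝ) < 2 ^ β := by positivity
    nlinarith

/-- Dyadic double counting for the polar bodies at the points `p k` of an `r`-net. -/
lemma sum_ncard_localSet_le (h : IsDualPair C E X Y l m) {β : ℝ} (hβ : 0 < β) {K : ℝ}
    (hK : ∀ Q : ℝ, 1 ≤ Q → ((nearSet E X Y l Q (1 / Q)).ncard : ℝ) ≤ K * (Q ^ d * Q ^ β)) :
    ∃ K' > 0, ∀ Q σ δ r : ℝ, 0 < δ → δ ≤ 1 → 1 ≤ δ * Q → 1 ≤ σ → 0 < r → r * σ = δ →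
      ∀ (F : Finset (Fin d → ℤ)) (p : (Fin d → ℤ) → Fin d → ℝ),
      (∀ k ∈ F, p k ∈ E) → (∀ k ∈ F, (fun i => ⌊p k i / r⌋) = k) →
      ∑ k ∈ F, ((localSet (X (p k)) (Y (p k)) l (1 / (2 * δ)) (1 / (2 * σ)) (1 / (2 * Q))).ncard : ℝ)
        ≤ F.card + K' * ((1 / δ) ^ d * δ ^ (-β)) := by
  classical
  have hC := h.one_le
  have hK0 : 0 ≤ K := by
    have := (Nat.cast_nonneg _).trans (hK 1 le_rfl)
    simpa using this
  have h2β : (1 : ℝ) < 2 ^ β := Real.one_lt_rpow (by norm_num) hβ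
  have h2β' : (0 : ℝ) < 2 ^ β - 1 := by linarith
  refine ⟨(K + 1) * (2 ^ d * 2 ^ β) * (4 * C ^ 2 + 3) ^ d * (2 ^ β / (2 ^ β - 1)), by positivity, ?_⟩
  intro Q σ δ r hδ hδ1 hδQ hσ hr hrσ F p hpE hpF
  have hQ1 : 1 ≤ Q := by nlinarith
  have hQδ : 1 / δ ≤ Q := by rw [div_le_iff₀ hδ]; linarith
  set L : (Fin d → ℤ) → Set (ι → ℤ) := fun k =>
    localSet (X (p k)) (Y (p k)) l (1 / (2 * δ)) (1 / (2 * σ)) (1 / (2 * Q)) with hL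
  have hLfin : ∀ k, (L k).Finite := fun k => finite_localSet _ _ _ _ _ _
  set J := Nat.log 2 ⌊1 / δ⌋₊ with hJ
  have hpowJ : ∀ i ∈ Finset.range (J + 1), (2 : ℝ) ^ i ≤ 1 / δ := by
    intro i hi
    have h2 : 1 ≤ ⌊1 / δ⌋₊ := Nat.le_floor (by rw [Nat.cast_one]; exact one_le_one_div hδ hδ1)
    have h3 : 2 ^ i ≤ ⌊1 / δ⌋₊ :=
      (Nat.pow_le_pow_right (by norm_num) (Nat.lt_succ_iff.mp (Finset.mem_range.mp hi))).trans
        (Nat.pow_log_le_self 2 (by omega))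
    exact le_trans (by exact_mod_cast h3) (Nat.floor_le (by positivity))
  set A : ℕ → Finset (ι → ℤ) := fun i =>
    ((finite_nearSet h (2 ^ (i + 1)) (1 / 2 ^ (i + 1))).toFinset).filter
      (fun a => (2 : ℝ) ^ i / (2 * C) ≤ |l ⬝ᵥ toRealVec a|) with hA
  have hσ2 : 1 / (2 * σ) ≤ 1 / 2 := one_div_le_one_div_of_le (by norm_num) (by linarith)
  have hsub : ∀ k ∈ F, (hLfin k).toFinset ⊆
      insert 0 ((Finset.range (J + 1)).biUnion fun i => (A i).filter fun a => a ∈ L k) := by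
    intro k hk a ha
    rw [Set.Finite.mem_toFinset] at ha
    rw [Finset.mem_insert, or_iff_not_imp_left]
    intro ha0
    set b := |l ⬝ᵥ toRealVec a| with hb
    have hbδ : b ≤ 1 / (2 * δ) := ha.1
    have hlow : 1 / (2 * C) ≤ b := le_height h (hpE k hk) hσ2 ha ha0
    have hbδ' : b ≤ 1 / δ := hbδ.trans (one_div_le_one_div_of_le hδ (by linarith))
    obtain ⟨i, hi, hi1, hi2⟩ : ∃ i ∈ Finset.range (J + 1), (2 : ℝ) ^ i / (2 * C) ≤ b ∧
        b ≤ 2 ^ (i + 1) := by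
      rcases lt_or_ge b 1 with hb1 | hb1
      · exact ⟨0, by simp, by simpa using hlow, by norm_num; linarith⟩
      · have hf : ⌊b⌋₊ ≠ 0 := by
          have : 1 ≤ ⌊b⌋₊ := Nat.le_floor (by simpa using hb1)
          omega
        refine ⟨Nat.log 2 ⌊b⌋₊, ?_, ?_, ?_⟩
        · rw [Finset.mem_range, Nat.lt_succ_iff]
          exact Nat.log_mono_right (Nat.floor_le_floor hbδ')
        · have h1 : ((2 ^ Nat.log 2 ⌊b⌋₊ : ℕ) : ℝ) ≤ ⌊b⌋₊ := by
            exact_mod_cast Nat.pow_log_le_self 2 hf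
          push_cast at h1
          have h2 := Nat.floor_le (by linarith : 0 ≤ b)
          rw [div_le_iff₀ (by linarith)]
          nlinarith
        · have h1 : ⌊b⌋₊ + 1 ≤ 2 ^ (Nat.log 2 ⌊b⌋₊ + 1) :=
            Nat.lt_pow_succ_log_self (by norm_num) _
          have h2 : ((⌊b⌋₊ : ℝ) + 1) ≤ 2 ^ (Nat.log 2 ⌊b⌋₊ + 1) := by exact_mod_cast h1
          linarith [Nat.lt_floor_add_one b]
    refine Finset.mem_biUnion.mpr ⟨i, hi, Finset.mem_filter.mpr ⟨Finset.mem_filter.mpr ⟨?_, hi1⟩, ha⟩⟩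
    rw [Set.Finite.mem_toFinset]
    refine ⟨p k, hpE k hk, localSet_mono le_rfl ?_ ?_ ⟨hi2, ha.2.1, ha.2.2⟩⟩
    · rw [one_div_mul_cancel (by positivity), Real.sqrt_one]; linarith
    · refine one_div_le_one_div_of_le (by positivity) ?_
      rw [pow_succ]
      linarith [hpowJ i hi]
  have hfib : ∀ i ∈ Finset.range (J + 1), ∀ a ∈ A i,
      ((F.filter fun k => a ∈ L k).card : ℝ) ≤ ((4 * C ^ 2 + 3) * ((1 / δ) / 2 ^ i)) ^ d := by
    intro i hi a ha
    have hpi : (0 : ℝ) < 2 ^ i := by positivity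
    have h1δ : 1 ≤ (1 / δ) / 2 ^ i := by
      rw [le_div_iff₀ hpi, one_mul]; exact hpowJ i hi
    have hab := (Finset.mem_filter.mp ha).2
    have hpos : 0 < |l ⬝ᵥ toRealVec a| := lt_of_lt_of_le (by positivity) hab
    rcases (F.filter fun k => a ∈ L k).eq_empty_or_nonempty with he | ⟨k₀, hk₀⟩
    · rw [he, Finset.card_empty, Nat.cast_zero]
      positivity
    obtain ⟨hk₀F, hk₀L⟩ := Finset.mem_filter.mp hk₀
    set R := 2 * C ^ 2 * ((1 / δ) / 2 ^ i) with hR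
    have hR0 : 0 ≤ R := by positivity
    have hmaps : ∀ k ∈ F.filter fun k => a ∈ L k, ‖toRealVec (k - k₀)‖ ≤ R + 1 := by
      intro k hk
      obtain ⟨hkF, hkL⟩ := Finset.mem_filter.mp hk
      have h3 := norm_sub_le_of_mem_localSet h (hpE k hkF) (hpE k₀ hk₀F) hkL hk₀L hpos
      have h4 : C * (2 * (1 / (2 * σ)) / |l ⬝ᵥ toRealVec a|) ≤ R * r := by
        have h5 : 2 * (1 / (2 * σ)) / |l ⬝ᵥ toRealVec a| ≤ 2 * (1 / (2 * σ)) / (2 ^ i / (2 * C)) := by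
          gcongr
        refine (mul_le_mul_of_nonneg_left h5 (by linarith)).trans (le_of_eq ?_)
        rw [hR, ← hrσ]
        field_simp
      have h6 := norm_floor_sub_le hr (h3.trans h4)
      rw [hpF k hkF, hpF k₀ hk₀F, mul_div_cancel_right₀ _ hr.ne'] at h6
      exact h6
    have hcard : (F.filter fun k => a ∈ L k).card ≤
        {w : Fin d → ℤ | ‖toRealVec w‖ ≤ R + 1}.ncard := by
      rw [← Set.ncard_coe_finset]
      refine Set.ncard_le_ncard_of_injOn (fun k => k - k₀) (fun k hk => hmaps k hk) ?_
        (finite_norm_toRealVec_le _)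
      intro k _ k' _ hkk
      simpa using hkk
    calc ((F.filter fun k => a ∈ L k).card : ℝ)
        ≤ ({w : Fin d → ℤ | ‖toRealVec w‖ ≤ R + 1}.ncard : ℝ) := by exact_mod_cast hcard
      _ ≤ (2 * (R + 1) + 1) ^ d := by
          have := ncard_norm_toRealVec_le (ι := Fin d) (by linarith : 0 ≤ R + 1)
          simpa using this
      _ ≤ _ := by
          refine pow_le_pow_left₀ (by positivity) ?_ _
          rw [hR]; nlinarith
  have hAcard : ∀ i, ((A i).card : ℝ) ≤ K * ((2 ^ (i + 1)) ^ d * (2 ^ (i + 1)) ^ β) := by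
    intro i
    refine le_trans ?_ (hK (2 ^ (i + 1)) (one_le_pow₀ (by norm_num)))
    rw [Set.ncard_eq_toFinset_card _ (finite_nearSet h (2 ^ (i + 1)) (1 / 2 ^ (i + 1)))]
    exact Nat.cast_le.mpr (Finset.card_filter_le _ _)
  have hstep : ∀ i ∈ Finset.range (J + 1), ∑ k ∈ F, (((A i).filter fun a => a ∈ L k).card : ℝ) ≤
      (K + 1) * (2 ^ d * 2 ^ β) * (4 * C ^ 2 + 3) ^ d * (1 / δ) ^ d * ((2 : ℝ) ^ i) ^ β := by
    intro i hi
    refine (sum_card_filter_le F (A i) (fun k a => a ∈ L k) _ (hfib i hi)).trans ?_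
    calc ((A i).card : ℝ) * ((4 * C ^ 2 + 3) * ((1 / δ) / 2 ^ i)) ^ d
        ≤ ((K + 1) * ((2 ^ (i + 1)) ^ d * (2 ^ (i + 1)) ^ β)) *
          ((4 * C ^ 2 + 3) * ((1 / δ) / 2 ^ i)) ^ d := by
          gcongr
          refine (hAcard i).trans ?_
          gcongr
          linarith
      _ = _ := by
          rw [pow_succ, Real.mul_rpow (by positivity) (by norm_num), mul_pow, mul_pow, div_pow]
          field_simp
  calc ∑ k ∈ F, ((L k).ncard : ℝ)
      ≤ ∑ k ∈ F, (1 + ∑ i ∈ Finset.range (J + 1), (((A i).filter fun a => a ∈ L k).card : ℝ)) := by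
        refine Finset.sum_le_sum fun k hk => ?_
        rw [Set.ncard_eq_toFinset_card _ (hLfin k)]
        have h1 := (Finset.card_le_card (hsub k hk)).trans (Finset.card_insert_le _ _)
        have h2 := h1.trans (Nat.add_le_add_right Finset.card_biUnion_le 1)
        have h3 : ((hLfin k).toFinset.card : ℝ) ≤
            ∑ i ∈ Finset.range (J + 1), (((A i).filter fun a => a ∈ L k).card : ℝ) + 1 := by
          exact_mod_cast h2
        linarith
    _ = F.card + ∑ i ∈ Finset.range (J + 1), ∑ k ∈ F, (((A i).filter fun a => a ∈ L k).card : ℝ) := by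
        rw [Finset.sum_add_distrib, Finset.sum_comm]; simp
    _ ≤ F.card + ∑ i ∈ Finset.range (J + 1),
        (K + 1) * (2 ^ d * 2 ^ β) * (4 * C ^ 2 + 3) ^ d * (1 / δ) ^ d * ((2 : ℝ) ^ i) ^ β := by
        gcongr with i hi
        exact hstep i hi
    _ ≤ F.card + (K + 1) * (2 ^ d * 2 ^ β) * (4 * C ^ 2 + 3) ^ d * (1 / δ) ^ d *
        (2 ^ β / (2 ^ β - 1) * δ ^ (-β)) := by
        rw [← Finset.mul_sum]
        gcongr
        exact sum_two_rpow_le hβ hδ hδ1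
    _ = _ := by ring

end Bootstrap

section Counting

variable {ι : Type} [Fintype ι] {d : ℕ}
variable {C : ℝ} {E : Set (Fin d → ℝ)} {X Y : (Fin d → ℝ) → ι → ℝ} {l m : ι → ℝ}

/-- An `r`-net of the parameter set, indexed by the cells of side `r` that meet it. -/
lemma exists_net (hE : ∀ t ∈ E, ‖t‖ ≤ C) {r : ℝ} (hr : 0 < r) (hr1 : r ≤ 1) (hC : 0 ≤ C) :
    ∃ (F : Finset (Fin d → ℤ)) (p : (Fin d → ℤ) → Fin d → ℝ),
      (F.card : ℝ) ≤ ((2 * C + 3) * (1 / r)) ^ d ∧ (∀ k ∈ F, p k ∈ E) ∧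
      (∀ k ∈ F, (fun i => ⌊p k i / r⌋) = k) ∧ ∀ t ∈ E, ∃ k ∈ F, ‖t - p k‖ ≤ r := by
  classical
  set F := (finite_norm_toRealVec_le (ι := Fin d) (C / r + 1)).toFinset.filter
    fun k => ∃ t ∈ E, (fun i => ⌊t i / r⌋) = k with hF
  have hp : ∀ k, ∃ t, k ∈ F → t ∈ E ∧ (fun i => ⌊t i / r⌋) = k := by
    intro k
    by_cases hk : k ∈ F
    · obtain ⟨t, ht⟩ := (Finset.mem_filter.mp hk).2
      exact ⟨t, fun _ => ht⟩
    · exact ⟨0, fun h => absurd h hk⟩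
  choose p hp using hp
  refine ⟨F, p, ?_, fun k hk => (hp k hk).1, fun k hk => (hp k hk).2, ?_⟩
  · have h1 : (F.card : ℝ) ≤ ({w : Fin d → ℤ | ‖toRealVec w‖ ≤ C / r + 1}.ncard : ℝ) := by
      rw [Set.ncard_eq_toFinset_card _ (finite_norm_toRealVec_le _)]
      exact Nat.cast_le.mpr (Finset.card_filter_le _ _)
    have h2 := ncard_norm_toRealVec_le (ι := Fin d) (by positivity : 0 ≤ C / r + 1)
    rw [Fintype.card_fin] at h2
    refine h1.trans (h2.trans (pow_le_pow_left₀ (by positivity) ?_ _))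
    have : 1 ≤ 1 / r := one_le_one_div hr hr1
    rw [div_eq_mul_one_div C r]
    nlinarith
  · intro t ht
    have hmem : (fun i => ⌊t i / r⌋) ∈ F := by
      refine Finset.mem_filter.mpr ⟨?_, t, ht, rfl⟩
      rw [Set.Finite.mem_toFinset]
      have h0 : ‖t - 0‖ ≤ C := by simpa using hE t ht
      have := norm_floor_sub_le hr h0
      have h1 : (fun i => ⌊(0 : Fin d → ℝ) i / r⌋) = (0 : Fin d → ℤ) := by ext i; simp
      rwa [h1, sub_zero] at this
    refine ⟨_, hmem, ?_⟩
    have hfl := (hp _ hmem).2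
    set p₀ := p fun i => ⌊t i / r⌋
    rw [pi_norm_le_iff_of_nonneg hr.le]
    intro i
    have h1 : ⌊p₀ i / r⌋ = ⌊t i / r⌋ := congrFun hfl i
    have h2 := Int.abs_sub_lt_one_of_floor_eq_floor h1.symm
    rw [← sub_div, abs_div, abs_of_pos hr, div_lt_one hr] at h2
    exact h2.le

lemma ncard_nearSet_le (h : IsDualPair C E X Y l m) (hι : Fintype.card ι = d + 2) (hd : 2 ≤ d)
    {β : ℝ} (hβ : 0 < β) {K : ℝ}
    (hK : ∀ Q : ℝ, 1 ≤ Q → ((nearSet E Y X m Q (1 / Q)).ncard : ℝ) ≤ K * (Q ^ d * Q ^ β)) :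
    ∃ K' > 0, ∀ Q δ : ℝ, 0 < Q → 0 < δ → δ ≤ 1 → 1 / Q ≤ δ ^ (1 + β) →
      ((nearSet E X Y l Q δ).ncard : ℝ) ≤ K' * (δ * Q ^ (d + 1)) := by
  classical
  have hC := h.one_le
  have : Nonempty ι := Fintype.card_pos_iff.mp (by omega)
  obtain ⟨K₁, hK₁, hlocal⟩ := ncard_localSet_le (ι := ι) hC
  obtain ⟨K₂, hK₂, hsum⟩ := sum_ncard_localSet_le h.symm hβ hK
  set M : ℝ := 2 + C + Fintype.card ι * C with hM
  have hM2 : 2 ≤ M := by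
    have : (0 : ℝ) ≤ Fintype.card ι * C := by positivity
    linarith
  refine ⟨K₁ * M ^ (d + 2) * ((2 * C + 3) ^ d + K₂), by positivity, ?_⟩
  intro Q δ hQ hδ hδ1 hQδ
  have hδβ : δ ^ (1 + β) ≤ δ := by
    have := Real.rpow_le_rpow_of_exponent_ge hδ hδ1 (by linarith : (1 : ℝ) ≤ 1 + β)
    rwa [Real.rpow_one] at this
  have hδQ : 1 ≤ δ * Q := by
    have := hQδ.trans hδβ
    rwa [div_le_iff₀ hQ] at this
  set σ := √(δ * Q) with hσ
  set r := √(δ / Q) with hr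
  have hr0 : 0 < r := Real.sqrt_pos.mpr (by positivity)
  have hσ1 : 1 ≤ σ := Real.one_le_sqrt.mpr hδQ
  have hσ2 : σ ^ 2 = δ * Q := Real.sq_sqrt (by positivity)
  have hr2 : r ^ 2 = δ / Q := Real.sq_sqrt (by positivity)
  have hrσ : r * σ = δ := by
    rw [hr, hσ, ← Real.sqrt_mul (by positivity), show δ / Q * (δ * Q) = δ ^ 2 by field_simp,
      Real.sqrt_sq hδ.le]
  have hrQ : r * Q = σ := by
    refine mul_right_cancel₀ (by positivity : σ ≠ 0) ?_
    rw [mul_right_comm, hrσ, ← hσ2, sq]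
  have hr1 : r ≤ 1 := by nlinarith
  have hrpow : (1 / δ) ^ d * δ ^ (-β) ≤ (1 / r) ^ d := by
    have h1 : r ≤ δ ^ (1 + β / 2) := by
      refine Real.sqrt_le_iff.mpr ⟨by positivity, ?_⟩
      rw [← Real.rpow_natCast, ← Real.rpow_mul hδ.le, div_eq_mul_one_div]
      calc δ * (1 / Q) ≤ δ * δ ^ (1 + β) := by gcongr
        _ = δ ^ (1 + (1 + β)) := by rw [Real.rpow_add hδ 1 (1 + β), Real.rpow_one]
        _ = _ := by congr 1; push_cast; ring
    have h2 : r ^ d ≤ δ ^ d * δ ^ β := by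
      calc r ^ d ≤ (δ ^ (1 + β / 2)) ^ d := by gcongr
        _ = δ ^ ((1 + β / 2) * d) := by rw [← Real.rpow_natCast, ← Real.rpow_mul hδ.le]
        _ ≤ δ ^ ((d : ℝ) + β) := by
            refine Real.rpow_le_rpow_of_exponent_ge hδ hδ1 ?_
            have : (2 : ℝ) ≤ d := by exact_mod_cast hd
            nlinarith
        _ = _ := by rw [Real.rpow_add hδ, Real.rpow_natCast]
    rw [Real.rpow_neg hδ.le, one_div_pow, one_div_pow, one_div, ← mul_inv, ← one_div]
    exact one_div_le_one_div_of_le (by positivity) h2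
  obtain ⟨F, p, hFcard, hpE, hpF, hnet⟩ := exists_net h.bdd hr0 hr1 (by linarith)
  have hsub : nearSet E X Y l Q δ ⊆
      ⋃ k ∈ F, localSet (X (p k)) (Y (p k)) l (M * Q) (M * σ) (M * δ) := by
    rintro w ⟨t, ht, hw⟩
    obtain ⟨k, hk, htk⟩ := hnet t ht
    exact Set.mem_biUnion hk (mem_localSet_of_near h ht (hpE k hk) htk hrQ hrσ hw)
  have hMσ : √(M * δ * (M * Q)) = M * σ := by
    rw [show M * δ * (M * Q) = M ^ 2 * (δ * Q) by ring, Real.sqrt_mul (by positivity),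
      Real.sqrt_sq (by linarith)]
  have hQ1 : δ ≤ Q := by nlinarith
  have hone : ∀ k ∈ F,
      ((localSet (X (p k)) (Y (p k)) l (M * Q) (M * σ) (M * δ)).ncard : ℝ) ≤
        K₁ * (M * σ) ^ (d + 2) *
        (localSet (Y (p k)) (X (p k)) m (1 / (2 * δ)) (1 / (2 * σ)) (1 / (2 * Q))).ncard := by
    intro k hk
    have hE := hpE k hk
    have h1 := hlocal (X (p k)) (Y (p k)) l m (h.norm_X _ hE) (h.norm_Y _ hE) h.norm_l h.norm_m
      (h.l_X _ hE) (h.m_Y _ hE) h.m_l (h.symm.Y_X_self hE) (M * Q) (M * δ) (by positivity)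
      (by gcongr)
    rw [hMσ, hι] at h1
    refine h1.trans ?_
    gcongr
    · exact finite_localSet _ _ _ _ _ _
    · apply localSet_mono <;> gcongr
  calc ((nearSet E X Y l Q δ).ncard : ℝ)
      ≤ ∑ k ∈ F, ((localSet (X (p k)) (Y (p k)) l (M * Q) (M * σ) (M * δ)).ncard : ℝ) := by
        refine le_trans (Nat.cast_le.mpr (Set.ncard_le_ncard hsub
          (F.finite_toSet.biUnion fun k _ => finite_localSet _ _ _ _ _ _))) ?_
        exact_mod_cast Finset.set_ncard_biUnion_le F _
    _ ≤ ∑ k ∈ F, K₁ * (M * σ) ^ (d + 2) *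
        (localSet (Y (p k)) (X (p k)) m (1 / (2 * δ)) (1 / (2 * σ)) (1 / (2 * Q))).ncard :=
        Finset.sum_le_sum hone
    _ ≤ K₁ * (M * σ) ^ (d + 2) * (((2 * C + 3) * (1 / r)) ^ d + K₂ * (1 / r) ^ d) := by
        rw [← Finset.mul_sum]
        gcongr
        refine (hsum Q σ δ r hδ hδ1 hδQ hσ1 hr0 hrσ F p hpE hpF).trans ?_
        gcongr
    _ = _ := by
        rw [← hrQ] at hσ2 ⊢
        have : δ = r ^ 2 * Q := by
          rw [hr2]; field_simp
        rw [this, mul_pow (2 * C + 3), one_div_pow, mul_pow M, mul_pow r]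
        field_simp
        ring

end Counting

section Iteration

variable {ι : Type} [Fintype ι] {d : ℕ}
variable {C : ℝ} {E : Set (Fin d → ℝ)} {X Y : (Fin d → ℝ) → ι → ℝ} {l m : ι → ℝ}

lemma exists_ncard_nearSet_le_trivial (h : IsDualPair C E X Y l m)
    (hι : Fintype.card ι = d + 2) :
    ∃ K : ℝ, ∀ Q : ℝ, 1 ≤ Q → ((nearSet E X Y l Q (1 / Q)).ncard : ℝ) ≤ K * (Q ^ d * Q ^ (2 : ℝ)) := by
  have hC := h.one_le
  refine ⟨(2 * C + 3) ^ (d + 2), fun Q hQ => ?_⟩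
  have hsub := nearSet_subset h (Q := Q) (δ := 1 / Q)
  rw [one_div_mul_cancel (by positivity), Real.sqrt_one] at hsub
  calc ((nearSet E X Y l Q (1 / Q)).ncard : ℝ)
      ≤ ({w : ι → ℤ | ‖toRealVec w‖ ≤ Q * C + 1}.ncard : ℝ) :=
        Nat.cast_le.mpr (Set.ncard_le_ncard hsub (finite_norm_toRealVec_le _))
    _ ≤ (2 * (Q * C + 1) + 1) ^ (d + 2) := by
        rw [← hι]; exact ncard_norm_toRealVec_le (by positivity)
    _ ≤ ((2 * C + 3) * Q) ^ (d + 2) := by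
        refine pow_le_pow_left₀ (by positivity) ?_ _
        nlinarith
    _ = _ := by
        rw [Real.rpow_two, mul_pow]; ring

lemma exists_ncard_nearSet_le_iterate (hι : Fintype.card ι = d + 2) (hd : 2 ≤ d) (k : ℕ) :
    ∀ {X Y : (Fin d → ℝ) → ι → ℝ} {l m : ι → ℝ}, IsDualPair C E X Y l m →
    ∃ K : ℝ, ∀ Q : ℝ, 1 ≤ Q →
      ((nearSet E X Y l Q (1 / Q)).ncard : ℝ) ≤ K * (Q ^ d * Q ^ (2 / (2 * (k : ℝ) + 1))) := by
  induction k with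
  | zero =>
    intro X Y l m h
    simpa using exists_ncard_nearSet_le_trivial h hι
  | succ k ih =>
    intro X Y l m h
    obtain ⟨K, hK⟩ := ih h.symm
    set β : ℝ := 2 / (2 * (k : ℝ) + 1) with hβ
    have hβ0 : 0 < β := by positivity
    obtain ⟨K', hK', hcount⟩ := ncard_nearSet_le h hι hd hβ0 hK
    refine ⟨K', fun Q hQ => ?_⟩
    have hQ0 : 0 < Q := by linarith
    have hexp : -(1 / (1 + β)) * (1 + β) = -1 := by field_simp
    have hle : 1 / Q ≤ Q ^ (-(1 / (1 + β))) := by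
      rw [one_div, ← Real.rpow_neg_one]
      refine Real.rpow_le_rpow_of_exponent_le hQ (neg_le_neg ?_)
      rw [div_le_one (by positivity)]; linarith
    calc ((nearSet E X Y l Q (1 / Q)).ncard : ℝ)
        ≤ ((nearSet E X Y l Q (Q ^ (-(1 / (1 + β))))).ncard : ℝ) :=
          Nat.cast_le.mpr (Set.ncard_le_ncard (nearSet_mono hQ0.le hle) (finite_nearSet h _ _))
      _ ≤ K' * (Q ^ (-(1 / (1 + β))) * Q ^ (d + 1)) := by
          refine hcount Q _ hQ0 (by positivity) ?_ ?_
          · refine Real.rpow_le_one_of_one_le_of_nonpos hQ ?_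
            rw [neg_nonpos]; positivity
          · rw [← Real.rpow_mul hQ0.le, hexp, Real.rpow_neg_one, one_div]
      _ = K' * (Q ^ d * Q ^ (2 / (2 * ((k + 1 : ℕ) : ℝ) + 1))) := by
          have h1 : (2 / (2 * ((k + 1 : ℕ) : ℝ) + 1)) = -(1 / (1 + β)) + 1 := by
            rw [hβ]; push_cast; field_simp; ring
          rw [h1, Real.rpow_add hQ0, Real.rpow_one]
          ring

/-- The number of rational points of height at most `Q` near the patch is bounded by the volume
heuristic as long as the neighbourhood is not too thin. -/
lemma exists_ncard_nearSet_le (h : IsDualPair C E X Y l m) (hι : Fintype.card ι = d + 2)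
    (hd : 2 ≤ d) {τ : ℝ} (hτ : 0 < τ) (hτ1 : τ < 1) :
    ∃ K > 0, ∀ Q δ : ℝ, 1 ≤ Q → Q ^ (-τ) ≤ δ → δ ≤ 1 →
      ((nearSet E X Y l Q δ).ncard : ℝ) ≤ K * (δ * Q ^ (d + 1)) := by
  have hτ' : 0 < 1 / τ - 1 := by
    rw [sub_pos, lt_div_iff₀ hτ]; linarith
  obtain ⟨k, hk⟩ := exists_nat_gt (2 / (1 / τ - 1))
  set β : ℝ := 2 / (2 * (k : ℝ) + 1) with hβ
  have hβ0 : 0 < β := by positivity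
  have hβτ : τ * (1 + β) ≤ 1 := by
    have h1 : β ≤ 1 / τ - 1 := by
      rw [div_lt_iff₀ hτ'] at hk
      rw [hβ, div_le_iff₀ (by positivity)]
      have : (0 : ℝ) ≤ k := Nat.cast_nonneg k
      nlinarith
    calc τ * (1 + β) ≤ τ * (1 + (1 / τ - 1)) := by gcongr
      _ = 1 := by field_simp; ring
  obtain ⟨K, hK⟩ := exists_ncard_nearSet_le_iterate hι hd k h.symm
  obtain ⟨K', hK', hcount⟩ := ncard_nearSet_le h hι hd hβ0 hK
  refine ⟨K', hK', fun Q δ hQ hδ hδ1 => ?_⟩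
  have hQ0 : 0 < Q := by linarith
  refine hcount Q δ hQ0 (lt_of_lt_of_le (by positivity) hδ) hδ1 ?_
  calc 1 / Q = Q ^ (-1 : ℝ) := by rw [Real.rpow_neg_one, one_div]
    _ ≤ Q ^ (-τ * (1 + β)) := Real.rpow_le_rpow_of_exponent_le hQ (by linarith)
    _ = (Q ^ (-τ)) ^ (1 + β) := Real.rpow_mul hQ0.le _ _
    _ ≤ δ ^ (1 + β) := Real.rpow_le_rpow (by positivity) hδ (by linarith)

end Iteration

section Charts

variable {d : ℕ}

/-- The gradient of `f` in coordinates. -/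
noncomputable def gradVec (f : (Fin d → ℝ) → ℝ) (t : Fin d → ℝ) : Fin d → ℝ :=
  fun j => fderiv ℝ f t (Pi.single j 1)

lemma gradVec_dotProduct (f : (Fin d → ℝ) → ℝ) (t v : Fin d → ℝ) :
    gradVec f t ⬝ᵥ v = fderiv ℝ f t v := by
  conv_rhs => rw [← Finset.univ_sum_single v, map_sum]
  refine Finset.sum_congr rfl fun j _ => ?_
  rw [gradVec, mul_comm, ← smul_eq_mul, ← map_smul, ← Pi.single_smul, smul_eq_mul, mul_one]

lemma contDiffAt_gradVec {f : (Fin d → ℝ) → ℝ} {y : Fin d → ℝ} (hf : ContDiffAt ℝ 2 f y) :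
    ContDiffAt ℝ 1 (gradVec f) y := by
  rw [contDiffAt_pi]
  intro j
  exact (hf.fderiv_right (m := 1) (by norm_num)).clm_apply contDiffAt_const

lemma fderiv_gradVec {f : (Fin d → ℝ) → ℝ} {y : Fin d → ℝ} (hf : ContDiffAt ℝ 2 f y)
    (v : Fin d → ℝ) : fderiv ℝ (gradVec f) y v = Matrix.vecMul v (hess f y) := by
  have hg : HasFDerivAt (gradVec f) (fderiv ℝ (gradVec f) y) y :=
    ((contDiffAt_gradVec hf).differentiableAt (by norm_num)).hasFDerivAt
  ext j
  have hj := (hasFDerivAt_pi'.mp hg j).fderiv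
  have h1 : ∀ i, hess f y i j = fderiv ℝ (gradVec f) y (Pi.single i 1) j := by
    intro i
    have : hess f y i j = fderiv ℝ (fun t => gradVec f t j) y (Pi.single i 1) := rfl
    rw [this, hj]; rfl
  simp only [Matrix.vecMul, dotProduct, h1]
  conv_lhs => rw [← Finset.univ_sum_single v, map_sum, Finset.sum_apply]
  refine Finset.sum_congr rfl fun i _ => ?_
  rw [← smul_eq_mul, ← Pi.smul_apply, ← map_smul, ← Pi.single_smul, smul_eq_mul, mul_one]

/-- Nonvanishing curvature makes the Gauss map locally bi-Lipschitz. -/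
lemma exists_norm_sub_le_gradVec {f : (Fin d → ℝ) → ℝ} {y : Fin d → ℝ} (hf : ContDiffAt ℝ 2 f y)
    (hdet : (hess f y).det ≠ 0) : ∃ K : ℝ, ∃ U ∈ nhds y, ∀ t ∈ U, ∀ t' ∈ U,
      ‖t - t'‖ ≤ K * ‖gradVec f t - gradVec f t'‖ := by
  obtain ⟨g', hg'⟩ : ∃ g', fderiv ℝ (gradVec f) y = g' := ⟨_, rfl⟩
  have hinj : Function.Injective g' := by
    have h1 := Matrix.vecMul_injective_iff_isUnit.mpr
      ((Matrix.isUnit_iff_isUnit_det _).mpr hdet.isUnit)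
    intro v w hvw
    apply h1
    simpa only [← hg', fderiv_gradVec hf] using hvw
  obtain ⟨K, hK, hanti⟩ := LinearMap.exists_antilipschitzWith (g' : (Fin d → ℝ) →ₗ[ℝ] Fin d → ℝ)
    (LinearMap.ker_eq_bot.mpr hinj)
  have hK0 : (0 : ℝ) < K := hK
  have hstrict := (contDiffAt_gradVec hf).hasStrictFDerivAt (by norm_num)
  rw [hg'] at hstrict
  obtain ⟨U, hU, happrox⟩ := hstrict.approximates_deriv_on_nhds (c := (2 * K)⁻¹)
    (Or.inr (by positivity))
  refine ⟨2 * K, U, hU, fun t ht t' ht' => ?_⟩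
  have h1 : ‖gradVec f t - gradVec f t' - g' (t - t')‖ ≤ 1 / (2 * K) * ‖t - t'‖ := by
    simpa only [NNReal.coe_inv, NNReal.coe_mul, NNReal.coe_ofNat, one_div] using happrox t ht t' ht'
  have h2 := hanti.le_mul_dist t t'
  rw [dist_eq_norm, dist_eq_norm, ← map_sub] at h2
  have h3 : ‖g' (t - t')‖ ≤ ‖gradVec f t - gradVec f t'‖ + 1 / (2 * K) * ‖t - t'‖ := by
    have h4 := norm_sub_le (gradVec f t - gradVec f t')
      (gradVec f t - gradVec f t' - g' (t - t'))
    rw [sub_sub_cancel] at h4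
    exact h4.trans (add_le_add le_rfl h1)
  have h5 : ‖t - t'‖ ≤ K * (‖gradVec f t - gradVec f t'‖ + 1 / (2 * K) * ‖t - t'‖) :=
    h2.trans (mul_le_mul_of_nonneg_left h3 hK0.le)
  have h6 : K * (‖gradVec f t - gradVec f t'‖ + 1 / (2 * K) * ‖t - t'‖) =
      K * ‖gradVec f t - gradVec f t'‖ + ‖t - t'‖ / 2 := by field_simp
  linarith

lemma exists_abs_taylor_le {f : (Fin d → ℝ) → ℝ} {y : Fin d → ℝ} (hf : ContDiffAt ℝ 2 f y) :
    ∃ K : ℝ, 0 ≤ K ∧ ∃ ρ > 0, ∀ t ∈ Metric.ball y ρ, ∀ t' ∈ Metric.ball y ρ,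
      |f t' - f t - gradVec f t ⬝ᵥ (t' - t)| ≤ K * ‖t - t'‖ ^ 2 := by
  obtain ⟨K, U, hU, hlip⟩ := (hf.fderiv_right (m := 1) (by norm_num)).exists_lipschitzOnWith
  have hdiff : ∀ᶠ t in nhds y, DifferentiableAt ℝ f t :=
    (hf.eventually (by norm_num)).mono fun t ht => ht.differentiableAt (by norm_num)
  obtain ⟨ρ, hρ, hball⟩ := Metric.mem_nhds_iff.mp (Filter.inter_mem hU hdiff)
  refine ⟨K, K.2, ρ, hρ, fun t ht t' ht' => ?_⟩
  have hseg : segment ℝ t t' ⊆ Metric.ball y ρ := (convex_ball y ρ).segment_subset ht ht'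
  have h := Convex.norm_image_sub_le_of_norm_hasFDerivWithin_le' (f := f) (f' := fderiv ℝ f)
    (φ := fderiv ℝ f t) (s := segment ℝ t t') (x := t) (y := t') (C := K * ‖t - t'‖)
    (fun u hu => (hball (hseg hu)).2.hasFDerivAt.hasFDerivWithinAt)
    (fun u hu => ?_) (convex_segment t t') (left_mem_segment ℝ t t') (right_mem_segment ℝ t t')
  · rw [gradVec_dotProduct, ← Real.norm_eq_abs]
    refine h.trans (le_of_eq ?_)
    rw [norm_sub_rev t' t]; ring
  · refine (hlip.norm_sub_le (hball (hseg hu)).1 (hball ht).1).trans ?_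
    gcongr
    rw [norm_sub_rev t t']
    exact norm_sub_le_of_mem_segment hu

end Charts

section ChartDualPairs

variable {d : ℕ}

lemma exists_graph_bounds {f : (Fin d → ℝ) → ℝ} {y : Fin d → ℝ} (hf : ContDiffAt ℝ 2 f y)
    (hdet : (hess f y).det ≠ 0) : ∃ C : ℝ, 1 ≤ C ∧ ∃ ρ > 0, ∀ t ∈ Metric.ball y ρ,
      ‖t‖ ≤ C ∧ |f t| ≤ C ∧ ‖gradVec f t‖ ≤ C ∧ ∀ t' ∈ Metric.ball y ρ,
        |f t - f t'| ≤ C * ‖t - t'‖ ∧ ‖gradVec f t - gradVec f t'‖ ≤ C * ‖t - t'‖ ∧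
        ‖t - t'‖ ≤ C * ‖gradVec f t - gradVec f t'‖ ∧
        |f t' - f t - gradVec f t ⬝ᵥ (t' - t)| ≤ C * ‖t - t'‖ ^ 2 := by
  have hg := contDiffAt_gradVec hf
  obtain ⟨K₁, U₁, hU₁, hlip₁⟩ := (hf.of_le (by norm_num : (1 : WithTop ℕ∞) ≤ 2)).exists_lipschitzOnWith
  obtain ⟨K₂, U₂, hU₂, hlip₂⟩ := hg.exists_lipschitzOnWith
  obtain ⟨K₃, U₃, hU₃, hanti⟩ := exists_norm_sub_le_gradVec hf hdet
  obtain ⟨K₄, hK₄, ρ₄, hρ₄, htaylor⟩ := exists_abs_taylor_le hf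
  have hcf : ∀ᶠ t in nhds y, |f t| < |f y| + 1 :=
    hf.continuousAt.abs.eventually_lt_const (by simp)
  have hcg : ∀ᶠ t in nhds y, ‖gradVec f t‖ < ‖gradVec f y‖ + 1 :=
    hg.continuousAt.norm.eventually_lt_const (by simp)
  have hct : ∀ᶠ t in nhds y, ‖t‖ < ‖y‖ + 1 :=
    continuous_norm.continuousAt.eventually_lt_const (by simp)
  obtain ⟨ρ, hρ, hball⟩ := Metric.mem_nhds_iff.mp (Filter.inter_mem (Filter.inter_mem hU₁
    (Filter.inter_mem hU₂ (Filter.inter_mem hU₃ (Metric.ball_mem_nhds y hρ₄))))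
    (hcf.and (hcg.and hct)))
  have hK₁ := K₁.2
  have hK₂ := K₂.2
  have h1 := abs_nonneg (f y)
  have h2 := norm_nonneg (gradVec f y)
  have h3 := norm_nonneg y
  have h4 := le_abs_self K₃
  have h5 := abs_nonneg K₃
  refine ⟨1 + K₁ + K₂ + |K₃| + K₄ + |f y| + ‖gradVec f y‖ + ‖y‖, ?_, ρ, hρ, fun t ht => ?_⟩
  · linarith [K₁.coe_nonneg, K₂.coe_nonneg]
  obtain ⟨⟨ht1, ht2, ht3, ht4⟩, ht5, ht6, ht7⟩ := hball ht
  have h6 := K₁.coe_nonneg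
  have h7 := K₂.coe_nonneg
  refine ⟨by linarith [ht7.le], by linarith [ht5.le], by linarith [ht6.le], fun t' ht' => ?_⟩
  obtain ⟨⟨ht1', ht2', ht3', ht4'⟩, -⟩ := hball ht'
  refine ⟨?_, ?_, ?_, ?_⟩
  · refine (hlip₁.norm_sub_le ht1 ht1').trans ?_
    gcongr
    linarith
  · refine (hlip₂.norm_sub_le ht2 ht2').trans ?_
    gcongr
    linarith
  · refine (hanti t ht3 t' ht3').trans ?_
    gcongr
    linarith
  · refine (htaylor t ht4 t' ht4').trans ?_
    gcongr
    linarith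

lemma appendV_sub (t t' : Fin d → ℝ) (z z' : ℝ) :
    appendV (d + 1) d t z - appendV (d + 1) d t' z' = appendV (d + 1) d (t - t') (z - z') := by
  ext i
  simp only [appendV, Pi.sub_apply]
  split_ifs <;> rfl

lemma appendV_castSucc (t : Fin d → ℝ) (z : ℝ) (i : Fin d) :
    appendV (d + 1) d t z i.castSucc = t i := by
  simp [appendV]

lemma appendV_last (t : Fin d → ℝ) (z : ℝ) : appendV (d + 1) d t z (Fin.last d) = z := by
  simp [appendV]

lemma appendV_dotProduct (t t' : Fin d → ℝ) (z z' : ℝ) :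
    appendV (d + 1) d t z ⬝ᵥ appendV (d + 1) d t' z' = t ⬝ᵥ t' + z * z' := by
  simp [dotProduct, Fin.sum_univ_castSucc, appendV_castSucc, appendV_last]

lemma norm_appendV_le {t : Fin d → ℝ} {z R : ℝ} (ht : ‖t‖ ≤ R) (hz : |z| ≤ R) :
    ‖appendV (d + 1) d t z‖ ≤ R := by
  rw [pi_norm_le_iff_of_nonneg ((abs_nonneg z).trans hz)]
  intro i
  refine Fin.lastCases ?_ (fun i => ?_) i
  · rwa [appendV_last]
  · rw [appendV_castSucc]; exact (norm_le_pi_norm t i).trans ht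

lemma norm_le_norm_appendV (t : Fin d → ℝ) (z : ℝ) : ‖t‖ ≤ ‖appendV (d + 1) d t z‖ := by
  rw [pi_norm_le_iff_of_nonneg (norm_nonneg _)]
  intro i
  rw [← appendV_castSucc t z i]
  exact norm_le_pi_norm _ _

lemma norm_cons_le {k : ℕ} {a R : ℝ} {v : Fin k → ℝ} (ha : |a| ≤ R) (hv : ‖v‖ ≤ R) :
    ‖(Fin.cons a v : Fin (k + 1) → ℝ)‖ ≤ R := by
  rw [pi_norm_le_iff_of_nonneg ((abs_nonneg a).trans ha)]
  intro i
  refine Fin.cases ?_ (fun i => ?_) i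
  · simpa using ha
  · simpa using (norm_le_pi_norm v i).trans hv

lemma norm_le_norm_cons {k : ℕ} (a : ℝ) (v : Fin k → ℝ) :
    ‖v‖ ≤ ‖(Fin.cons a v : Fin (k + 1) → ℝ)‖ := by
  rw [pi_norm_le_iff_of_nonneg (norm_nonneg _)]
  intro i
  have := norm_le_pi_norm (Fin.cons a v : Fin (k + 1) → ℝ) i.succ
  simpa using this

lemma cons_sub_cons {k : ℕ} (a b : ℝ) (v w : Fin k → ℝ) :
    (Fin.cons a v : Fin (k + 1) → ℝ) - (Fin.cons b w : Fin (k + 1) → ℝ) =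
      (Fin.cons (a - b) (v - w) : Fin (k + 1) → ℝ) := by
  ext i
  refine Fin.cases ?_ (fun i => ?_) i <;> simp

lemma cons_dotProduct_cons {k : ℕ} (a b : ℝ) (v w : Fin k → ℝ) :
    (Fin.cons a v : Fin (k + 1) → ℝ) ⬝ᵥ (Fin.cons b w : Fin (k + 1) → ℝ) = a * b + v ⬝ᵥ w := by
  simp [dotProduct, Fin.sum_univ_succ]

lemma exists_norm_mulVec_le {k : ℕ} (A : Matrix (Fin k) (Fin k) ℝ) :
    ∃ c : ℝ, ∀ v, ‖A.mulVec v‖ ≤ c * ‖v‖ :=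
  ⟨_, (LinearMap.toContinuousLinearMap A.mulVecLin).le_opNorm⟩

lemma mulVec_dotProduct_mulVec {k : ℕ} {O : Matrix (Fin k) (Fin k) ℝ}
    (hO : O ∈ Matrix.orthogonalGroup (Fin k) ℝ) (v w : Fin k → ℝ) :
    O.mulVec v ⬝ᵥ O.mulVec w = v ⬝ᵥ w := by
  rw [Matrix.dotProduct_mulVec, Matrix.vecMul_mulVec, ← Matrix.conjTranspose_eq_transpose_of_trivial,
    ← Matrix.star_eq_conjTranspose, Matrix.mem_unitaryGroup_iff'.mp hO]
  simp

lemma exists_norm_mulVec_equiv {k : ℕ} {O : Matrix (Fin k) (Fin k) ℝ}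
    (hO : O ∈ Matrix.orthogonalGroup (Fin k) ℝ) :
    ∃ c : ℝ, 1 ≤ c ∧ ∀ v, ‖O.mulVec v‖ ≤ c * ‖v‖ ∧ ‖v‖ ≤ c * ‖O.mulVec v‖ := by
  obtain ⟨c₁, h₁⟩ := exists_norm_mulVec_le O
  obtain ⟨c₂, h₂⟩ := exists_norm_mulVec_le (star O)
  refine ⟨max 1 (max c₁ c₂), le_max_left _ _, fun v => ⟨(h₁ v).trans ?_, ?_⟩⟩
  · gcongr; exact (le_max_left _ _).trans (le_max_right _ _)
  · have h := h₂ (O.mulVec v)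
    rw [Matrix.mulVec_mulVec, Matrix.mem_unitaryGroup_iff'.mp hO, Matrix.one_mulVec] at h
    refine h.trans ?_
    gcongr; exact (le_max_right _ _).trans (le_max_right _ _)

/-- Homogeneous coordinates of the point of the rotated graph of `f` over `t`. -/
noncomputable def graphPoint (O : Matrix (Fin (d + 1)) (Fin (d + 1)) ℝ) (f : (Fin d → ℝ) → ℝ)
    (t : Fin d → ℝ) : Fin (d + 2) → ℝ :=
  Fin.cons 1 (O.mulVec (appendV (d + 1) d t (f t)))

/-- Homogeneous coordinates of the tangent hyperplane to the rotated graph of `f` over `t`. -/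
noncomputable def graphTangent (O : Matrix (Fin (d + 1)) (Fin (d + 1)) ℝ) (f : (Fin d → ℝ) → ℝ)
    (t : Fin d → ℝ) : Fin (d + 2) → ℝ :=
  Fin.cons (gradVec f t ⬝ᵥ t - f t) (O.mulVec (appendV (d + 1) d (-gradVec f t) 1))

lemma isDualPair_graph {O : Matrix (Fin (d + 1)) (Fin (d + 1)) ℝ}
    (hO : O ∈ Matrix.orthogonalGroup (Fin (d + 1)) ℝ) {f : (Fin d → ℝ) → ℝ} {y : Fin d → ℝ}
    (hf : ContDiffAt ℝ 2 f y) (hdet : (hess f y).det ≠ 0) :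
    ∃ C, ∃ ρ > 0, IsDualPair C (Metric.ball y ρ) (graphPoint O f) (graphTangent O f)
      (Fin.cons 1 0 : Fin (d + 2) → ℝ)
      (Fin.cons 0 (O.mulVec (appendV (d + 1) d 0 1)) : Fin (d + 2) → ℝ) := by
  obtain ⟨C, hC, ρ, hρ, hgraph⟩ := exists_graph_bounds hf hdet
  obtain ⟨c, hc, hcO⟩ := exists_norm_mulVec_equiv hO
  set M : ℝ := c * (3 * (d + 1) * C ^ 2) with hM
  have hd : (0 : ℝ) ≤ d := Nat.cast_nonneg d
  have hC2 : C ≤ C ^ 2 := by nlinarith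
  have hdC : 0 ≤ d * C ^ 2 := by positivity
  have hM1 : c * C ≤ M := by
    rw [hM]; gcongr; nlinarith
  have hCM : C ≤ M := by nlinarith
  have hcM : c ≤ M := by nlinarith
  have hvM : d * C * C + d * C * C + C ≤ M := by
    have h1 : d * C * C + d * C * C + C ≤ 3 * (d + 1) * C ^ 2 := by nlinarith
    refine h1.trans ?_
    rw [hM]
    nlinarith [show 0 ≤ 3 * (d + 1) * C ^ 2 by positivity]
  refine ⟨M, ρ, hρ, ?_⟩
  refine
    { one_le := by linarith
      bdd := fun t ht => (hgraph t ht).1.trans hCM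
      norm_l := norm_cons_le (by rw [abs_one]; linarith) (by rw [norm_zero]; linarith)
      norm_m := ?_
      m_l := ?_
      l_X := ?_
      m_Y := ?_
      norm_X := ?_
      norm_Y := ?_
      X_le := ?_
      Y_le := ?_
      le_X := ?_
      le_Y := ?_
      Y_X := ?_ }
  · refine norm_cons_le (by rw [abs_zero]; linarith) (((hcO _).1.trans ?_).trans hcM)
    refine mul_le_of_le_one_right (by linarith) (norm_appendV_le ?_ ?_) <;> simp
  · rw [cons_dotProduct_cons]; simp
  · intro t _
    rw [graphPoint, cons_dotProduct_cons]; simp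
  · intro t _
    rw [graphTangent, cons_dotProduct_cons, mulVec_dotProduct_mulVec hO, appendV_dotProduct]; simp
  · intro t ht
    obtain ⟨h1, h2, h3, -⟩ := hgraph t ht
    refine norm_cons_le (by rw [abs_one]; linarith) (((hcO _).1.trans ?_).trans hM1)
    gcongr
    exact norm_appendV_le h1 h2
  · intro t ht
    obtain ⟨h1, h2, h3, -⟩ := hgraph t ht
    refine norm_cons_le ?_ (((hcO _).1.trans ?_).trans hM1)
    · have h4 := abs_dotProduct_le (gradVec f t) t
      rw [Fintype.card_fin] at h4
      have h5 : (d : ℝ) * ‖gradVec f t‖ * ‖t‖ ≤ d * C * C := by gcongr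
      have h6 := abs_sub (gradVec f t ⬝ᵥ t) (f t)
      have h7 : 0 ≤ d * C * C := by positivity
      linarith
    · gcongr
      exact norm_appendV_le (by rwa [norm_neg]) (by rwa [abs_one])
  · intro t ht t' ht'
    obtain ⟨-, -, -, h⟩ := hgraph t ht
    obtain ⟨h1, -, -, -⟩ := h t' ht'
    rw [graphPoint, graphPoint, cons_sub_cons, ← Matrix.mulVec_sub, appendV_sub]
    refine norm_cons_le (by rw [sub_self, abs_zero]; positivity) (((hcO _).1.trans ?_).trans
      (mul_le_mul_of_nonneg_right hM1 (norm_nonneg _)))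
    rw [mul_assoc]
    gcongr
    exact norm_appendV_le (le_mul_of_one_le_left (norm_nonneg _) hC) h1
  · intro t ht t' ht'
    obtain ⟨h0, -, -, h⟩ := hgraph t ht
    obtain ⟨-, -, h0', -⟩ := hgraph t' ht'
    obtain ⟨h1, h2, -, -⟩ := h t' ht'
    rw [graphTangent, graphTangent, cons_sub_cons, ← Matrix.mulVec_sub, appendV_sub]
    refine norm_cons_le ?_ (((hcO _).1.trans ?_).trans
      (mul_le_mul_of_nonneg_right hM1 (norm_nonneg _)))
    · have h3 : gradVec f t ⬝ᵥ t - f t - (gradVec f t' ⬝ᵥ t' - f t') =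
          (gradVec f t - gradVec f t') ⬝ᵥ t + gradVec f t' ⬝ᵥ (t - t') - (f t - f t') := by
        rw [sub_dotProduct, dotProduct_sub]; ring
      have h4 := abs_dotProduct_le (gradVec f t - gradVec f t') t
      have h5 := abs_dotProduct_le (gradVec f t') (t - t')
      rw [Fintype.card_fin] at h4 h5
      have h6 : (d : ℝ) * ‖gradVec f t - gradVec f t'‖ * ‖t‖ ≤ d * (C * ‖t - t'‖) * C := by gcongr
      have h7 : (d : ℝ) * ‖gradVec f t'‖ * ‖t - t'‖ ≤ d * C * ‖t - t'‖ := by gcongr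
      have h8 : (d : ℝ) * C * ‖t - t'‖ ≤ d * C * ‖t - t'‖ * C := le_mul_of_one_le_right (by positivity) hC
      rw [h3]
      calc _ ≤ |(gradVec f t - gradVec f t') ⬝ᵥ t| + |gradVec f t' ⬝ᵥ (t - t')| + |f t - f t'| :=
            (abs_sub _ _).trans (add_le_add_left (abs_add_le _ _) _)
        _ ≤ (d * C * C + d * C * C + C) * ‖t - t'‖ := by linarith
        _ ≤ M * ‖t - t'‖ := by gcongr
    · rw [mul_assoc]
      gcongr
      refine norm_appendV_le ?_ (by rw [sub_self, abs_zero]; positivity)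
      rwa [neg_sub_neg, norm_sub_rev]
  · intro t ht t' ht'
    rw [graphPoint, graphPoint, cons_sub_cons, ← Matrix.mulVec_sub, appendV_sub]
    calc ‖t - t'‖ ≤ c * ‖O.mulVec (appendV (d + 1) d (t - t') (f t - f t'))‖ :=
          (norm_le_norm_appendV _ _).trans (hcO _).2
      _ ≤ _ := by gcongr; exact norm_le_norm_cons _ _
  · intro t ht t' ht'
    obtain ⟨-, -, h2, -⟩ := (hgraph t ht).2.2.2 t' ht'
    rw [graphTangent, graphTangent, cons_sub_cons, ← Matrix.mulVec_sub, appendV_sub, neg_sub_neg]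
    calc ‖t - t'‖ ≤ C * ‖gradVec f t' - gradVec f t‖ := by rwa [norm_sub_rev (gradVec f t')]
      _ ≤ C * (c * ‖O.mulVec (appendV (d + 1) d (gradVec f t' - gradVec f t) (1 - 1))‖) := by
          gcongr
          exact (norm_le_norm_appendV _ _).trans (hcO _).2
      _ = c * C * ‖O.mulVec (appendV (d + 1) d (gradVec f t' - gradVec f t) (1 - 1))‖ := by ring
      _ ≤ _ := by gcongr; exact norm_le_norm_cons _ _
  · intro t ht t' ht'
    obtain ⟨-, -, -, h3⟩ := (hgraph t ht).2.2.2 t' ht'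
    rw [graphTangent, graphPoint, cons_dotProduct_cons, mulVec_dotProduct_mulVec hO,
      appendV_dotProduct]
    refine le_trans (le_of_eq ?_) (h3.trans (by gcongr))
    rw [dotProduct_sub, neg_dotProduct]
    congr 1
    ring

end ChartDualPairs

section HausdorffCantelli

/-- Borel–Cantelli for Hausdorff measures. -/
lemma hausdorffMeasure_eq_zero_of_frequently {V β : Type*} [MetricSpace V] [MeasurableSpace V]
    [BorelSpace V] (B : ℕ → Finset β) (c : β → V) {r : ℕ → ℝ} (hr0 : ∀ k, 0 ≤ r k)
    (hr : Antitone r) (hr_lim : Filter.Tendsto r Filter.atTop (nhds 0)) {s : ℝ} (hs : 0 ≤ s)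
    (hsum : Summable fun k => ((B k).card : ℝ) * r k ^ s) {A : Set V}
    (hA : ∀ x ∈ A, ∃ᶠ k in Filter.atTop, ∃ w ∈ B k, dist x (c w) ≤ r k) : μH[s] A = 0 := by
  have hdiam : ∀ k w, Metric.ediam (Metric.closedBall (c w) (r k)) ≤ ENNReal.ofReal (2 * r k) :=
    fun k w => Metric.ediam_le_of_forall_dist_le fun x hx y hy => by
      have := dist_triangle_right x y (c w)
      linarith [Metric.mem_closedBall.mp hx, Metric.mem_closedBall.mp hy]
  set a : ℕ → ENNReal := fun k => ENNReal.ofReal (2 ^ s * (((B k).card : ℝ) * r k ^ s)) with ha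
  have hfin : ∑' k, a k ≠ ⊤ := (hsum.mul_left (2 ^ s)).tsum_ofReal_ne_top
  have htail := ENNReal.tendsto_sum_nat_add a hfin
  have hle := Measure.hausdorffMeasure_le_liminf_tsum (ι := fun m => Σ k, B (k + m)) s A
    (l := Filter.atTop) (fun m => ENNReal.ofReal (2 * r m)) ?_
    (fun m i => Metric.closedBall (c i.2) (r (i.1 + m))) ?_ ?_
  · refine le_antisymm (hle.trans ?_) bot_le
    rw [← htail.liminf_eq]
    refine Filter.liminf_le_liminf (Filter.Eventually.of_forall fun m => ?_)
    refine (ENNReal.tsum_sigma' _).le.trans (ENNReal.tsum_le_tsum fun k => ?_)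
    calc ∑' w : B (k + m), Metric.ediam (Metric.closedBall (c w) (r (k + m))) ^ s
        ≤ ∑' _ : B (k + m), ENNReal.ofReal (2 * r (k + m)) ^ s :=
          ENNReal.tsum_le_tsum fun w => ENNReal.rpow_le_rpow (hdiam _ _) hs
      _ = a (k + m) := by
          have h0 := hr0 (k + m)
          rw [tsum_fintype, Finset.sum_const, nsmul_eq_mul, ha,
            ENNReal.ofReal_rpow_of_nonneg (by positivity) hs, Finset.card_univ,
            Fintype.card_coe, ← ENNReal.ofReal_natCast, ← ENNReal.ofReal_mul (by positivity),
            Real.mul_rpow (by norm_num) h0]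
          congr 1
          ring
  · have := ENNReal.tendsto_ofReal (hr_lim.const_mul 2)
    simpa using this
  · refine Filter.Eventually.of_forall fun m i => (hdiam _ _).trans (ENNReal.ofReal_le_ofReal ?_)
    have := hr (Nat.le_add_left m i.1)
    linarith
  · refine Filter.Eventually.of_forall fun m x hx => ?_
    obtain ⟨k, hk, w, hw, hxw⟩ := Filter.frequently_atTop.mp (hA x hx) m
    obtain ⟨j, rfl⟩ := Nat.exists_eq_add_of_le' hk
    exact Set.mem_iUnion.mpr ⟨⟨j, w, hw⟩, hxw⟩

end HausdorffCantelli

section Dyadic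

variable {ψ : ℕ → ℝ} {n : ℕ} {s : ℝ}

/-- A one-sided Cauchy condensation for the weighted convergence series. -/
lemma summable_dyadic (hψpos : ∀ q, 0 < ψ q) (hψdec : Antitone ψ) (hs : 0 ≤ s + 1)
    (hsum : Summable fun q : ℕ =>
      (ψ (q + 1) / ((q : ℝ) + 1)) ^ (s + 1) * ((q : ℝ) + 1) ^ n) :
    Summable fun k : ℕ => (ψ (2 ^ k) / 2 ^ k) ^ (s + 1) * (2 ^ k : ℝ) ^ (n + 1) := by
  set G : ℕ → ℝ := fun q => (ψ (q + 1) / ((q : ℝ) + 1)) ^ (s + 1) * ((q : ℝ) + 1) ^ n with hG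
  have hG0 : ∀ q, 0 ≤ G q := fun q => by
    have := (hψpos (q + 1)).le
    positivity
  set T : ℕ → ℝ := fun k => (ψ (2 ^ k) / 2 ^ k) ^ (s + 1) * (2 ^ k : ℝ) ^ (n + 1) with hT
  have hT0 : ∀ k, 0 ≤ T k := fun k => by
    have := (hψpos (2 ^ k)).le
    positivity
  have hblock : ∀ k, T (k + 1) ≤ 2 ^ (n + 1) * ∑ q ∈ Finset.Ico (2 ^ k) (2 ^ (k + 1)), G q := by
    intro k
    have h1 : ∀ q ∈ Finset.Ico (2 ^ k) (2 ^ (k + 1)),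
        (ψ (2 ^ (k + 1)) / 2 ^ (k + 1)) ^ (s + 1) * (2 ^ k : ℝ) ^ n ≤ G q := by
      intro q hq
      obtain ⟨hq1, hq2⟩ := Finset.mem_Ico.mp hq
      have h2 : ((q : ℝ) + 1) ≤ 2 ^ (k + 1) := by exact_mod_cast hq2
      have h3 : (2 : ℝ) ^ k ≤ (q : ℝ) + 1 := by
        have : (2 : ℝ) ^ k ≤ q := by exact_mod_cast hq1
        linarith
      have h4 : ψ (2 ^ (k + 1)) ≤ ψ (q + 1) := hψdec hq2
      have h5 := (hψpos (2 ^ (k + 1))).le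
      have h6 := (hψpos (q + 1)).le
      simp only [hG]
      gcongr
    have h2 := Finset.card_nsmul_le_sum _ _ _ h1
    rw [Nat.card_Ico, nsmul_eq_mul, show 2 ^ (k + 1) - 2 ^ k = 2 ^ k by rw [pow_succ]; omega] at h2
    refine le_trans (le_of_eq ?_) (mul_le_mul_of_nonneg_left h2 (by positivity))
    simp only [hT]
    push_cast
    rw [pow_succ (2 : ℝ) k, mul_pow]
    ring
  have hpartial : ∀ N, ∑ k ∈ Finset.range N, T (k + 1) ≤
      2 ^ (n + 1) * ∑ q ∈ Finset.range (2 ^ N), G q := by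
    intro N
    induction N with
    | zero => simpa using hG0 0
    | succ N ih =>
      rw [Finset.sum_range_succ, ← Finset.sum_range_add_sum_Ico G
        (Nat.pow_le_pow_right (by norm_num) (Nat.le_succ N)), mul_add]
      exact add_le_add ih (hblock N)
  refine (summable_nat_add_iff 1).mp (summable_of_sum_range_le (c := 2 ^ (n + 1) * ∑' q, G q)
    (fun k => hT0 _) fun N => (hpartial N).trans ?_)
  gcongr
  exact hsum.sum_le_tsum _ fun q _ => hG0 q

end Dyadic

section Convergence

variable {ψ : ℕ → ℝ} {d : ℕ} {s : ℝ}

lemma div_rpow_mul_pow {x Q : ℝ} (hx : 0 ≤ x) (hQ : 0 < Q) (s : ℝ) (n : ℕ) :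
    (x / Q) ^ (s + 1) * Q ^ (n + 1) = x ^ (s + 1) * Q ^ ((n : ℝ) - s) := by
  rw [Real.div_rpow hx hQ.le, ← Real.rpow_natCast Q (n + 1), div_mul_eq_mul_div, mul_div_assoc,
    ← Real.rpow_sub hQ]
  congr 2
  push_cast
  ring

/-- Enlarging a convergent approximation function to one that decays no faster than a small
power. -/
lemma exists_dyadic_scale {n : ℕ} (hψpos : ∀ q, 0 < ψ q) (hψdec : Antitone ψ) {A η : ℝ}
    (hA : 0 ≤ A) (hη : 0 ≤ η) (hs : 0 ≤ s + 1) (hsn : s ≤ n) (hηs : (n : ℝ) - s < η * (s + 1))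
    (hsum : Summable fun k : ℕ => (ψ (2 ^ k) / 2 ^ k) ^ (s + 1) * (2 ^ k : ℝ) ^ (n + 1)) :
    ∃ δ : ℕ → ℝ, Antitone δ ∧ (∀ k, A * ψ (2 ^ k) ≤ δ k) ∧ (∀ k, (2 ^ k : ℝ) ^ (-η) ≤ δ k) ∧
      (∀ᶠ k in Filter.atTop, δ k ≤ 1) ∧
      Summable fun k : ℕ => (δ k / 2 ^ k) ^ (s + 1) * (2 ^ k : ℝ) ^ (n + 1) := by
  set δ : ℕ → ℝ := fun k => max (A * ψ (2 ^ k)) ((2 ^ k : ℝ) ^ (-η)) with hδ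
  have hδ0 : ∀ k, 0 < δ k := fun k => lt_max_of_lt_right (by positivity)
  have hδsum : Summable fun k : ℕ => (δ k / 2 ^ k) ^ (s + 1) * (2 ^ k : ℝ) ^ (n + 1) := by
    have hgeo : Summable fun k : ℕ => ((2 : ℝ) ^ ((n : ℝ) - s - η * (s + 1))) ^ k :=
      summable_geometric_of_lt_one (by positivity)
        (Real.rpow_lt_one_of_one_lt_of_neg (by norm_num) (by linarith))
    refine Summable.of_nonneg_of_le (fun k => ?_) (fun k => ?_)
      ((hsum.mul_left (A ^ (s + 1))).add hgeo)
    · have := (hδ0 k).le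
      positivity
    · have hψ := (hψpos (2 ^ k)).le
      have hQ : (0 : ℝ) < 2 ^ k := by positivity
      rw [div_rpow_mul_pow (hδ0 k).le hQ, div_rpow_mul_pow hψ hQ, ← mul_assoc,
        ← Real.mul_rpow hA hψ]
      have hpow : ((2 : ℝ) ^ ((n : ℝ) - s - η * (s + 1))) ^ k =
          ((2 ^ k : ℝ) ^ (-η)) ^ (s + 1) * (2 ^ k : ℝ) ^ ((n : ℝ) - s) := by
        rw [← Real.rpow_mul hQ.le, ← Real.rpow_add hQ, ← Real.rpow_natCast, ← Real.rpow_natCast,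
          ← Real.rpow_mul (by norm_num), ← Real.rpow_mul (by norm_num)]
        congr 1
        ring
      rw [hpow, ← add_mul]
      refine mul_le_mul_of_nonneg_right ?_ (by positivity)
      have h1 : 0 ≤ (A * ψ (2 ^ k)) ^ (s + 1) := by positivity
      have h2 : 0 ≤ ((2 ^ k : ℝ) ^ (-η)) ^ (s + 1) := by positivity
      rcases max_choice (A * ψ (2 ^ k)) ((2 ^ k : ℝ) ^ (-η)) with h | h
      · simp only [hδ, h]; linarith
      · simp only [hδ, h]; linarith
  refine ⟨δ, ?_, fun k => le_max_left _ _, fun k => le_max_right _ _, ?_, hδsum⟩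
  · intro j k hjk
    have h2 : (2 : ℝ) ^ j ≤ 2 ^ k := pow_le_pow_right₀ (by norm_num) hjk
    refine max_le_max (mul_le_mul_of_nonneg_left (hψdec ?_) hA)
      (Real.rpow_le_rpow_of_nonpos (by positivity) h2 (by linarith))
    exact Nat.pow_le_pow_right (by norm_num) hjk
  · filter_upwards [hδsum.tendsto_atTop_zero.eventually_lt_const one_pos] with k hk
    rw [div_rpow_mul_pow (hδ0 k).le (by positivity)] at hk
    by_contra! h
    have h1 := Real.one_le_rpow h.le hs
    have h2 : 1 ≤ (2 ^ k : ℝ) ^ ((n : ℝ) - s) :=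
      Real.one_le_rpow (one_le_pow₀ (by norm_num)) (by linarith)
    nlinarith

lemma exists_natAbs_ge_of_mem_simulApprox {n : ℕ} {x : Fin n → ℝ} (hx : x ∈ simulApprox n ψ)
    (N : ℕ) : ∃ q : ℤ, q ≠ 0 ∧ N ≤ q.natAbs ∧ ∀ i, nint (q * x i) < ψ q.natAbs := by
  obtain ⟨q, hq, hqN⟩ := Set.Infinite.exists_notMem_finite hx (Set.finite_Icc (-(N : ℤ)) N)
  refine ⟨q, hq.1, ?_, hq.2⟩
  rw [Set.mem_Icc] at hqN
  omega

variable {C : ℝ} {E : Set (Fin d → ℝ)} {Y : (Fin d → ℝ) → Fin (d + 2) → ℝ}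
  {m : Fin (d + 2) → ℝ} {p : (Fin d → ℝ) → Fin (d + 1) → ℝ}

/-- A good rational approximation to a point of the hypersurface is a lattice point near the cone
over it. -/
lemma cons_round_mem_nearSet
    (h : IsDualPair C E (fun t => (Fin.cons 1 (p t) : Fin (d + 2) → ℝ)) Y (Fin.cons 1 0) m)
    {t : Fin d → ℝ} (ht : t ∈ E) {q : ℤ} {Q ε δ : ℝ} (hq : |(q : ℝ)| ≤ Q) (hQ : 1 ≤ Q)
    (hδ1 : δ ≤ 1) (hεδ : (d + 2) * C * ε ≤ δ) (hε : 0 ≤ ε) (hqt : ∀ i, nint (q * p t i) ≤ ε) :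
    (Fin.cons q fun i => round (q * p t i) : Fin (d + 2) → ℤ) ∈
      nearSet E (fun t => (Fin.cons 1 (p t) : Fin (d + 2) → ℝ)) Y (Fin.cons 1 0) Q δ := by
  have hC := h.one_le
  set w : Fin (d + 2) → ℤ := Fin.cons q fun i => round (q * p t i) with hw
  set X : Fin (d + 2) → ℝ := Fin.cons 1 (p t) with hX
  have hlw : (Fin.cons 1 0 : Fin (d + 2) → ℝ) ⬝ᵥ toRealVec w = q := by
    simp [dotProduct, Fin.sum_univ_succ, toRealVec, hw]
  have hwX : ‖toRealVec w - (q : ℝ) • X‖ ≤ ε := by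
    rw [pi_norm_le_iff_of_nonneg hε]
    intro i
    refine Fin.cases ?_ (fun i => ?_) i
    · simpa [toRealVec, hw, hX] using hε
    · have := hqt i
      rw [nint, abs_sub_comm] at this
      simpa [toRealVec, hw, hX] using this
  have hδ0 : 0 ≤ δ := le_trans (by positivity) hεδ
  have hεδ' : ε ≤ δ := by
    have : 1 ≤ ((d : ℝ) + 2) * C := by nlinarith [(Nat.cast_nonneg d : (0 : ℝ) ≤ d)]
    nlinarith
  refine ⟨t, ht, ?_, ?_, ?_⟩
  · rwa [hlw]
  · rw [hlw]
    refine hwX.trans (hεδ'.trans (Real.le_sqrt_of_sq_le ?_))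
    nlinarith
  · have hYw : Y t ⬝ᵥ toRealVec w = Y t ⬝ᵥ (toRealVec w - (q : ℝ) • X) := by
      rw [dotProduct_sub, dotProduct_smul, h.Y_X_self ht, smul_zero, sub_zero]
    rw [hYw]
    refine (abs_dotProduct_le _ _).trans (le_trans ?_ hεδ)
    have := h.norm_Y t ht
    rw [Fintype.card_fin]
    push_cast
    gcongr

/-- The convergence theorem over a single dual pair. -/
lemma hausdorffMeasure_simulApprox_inter_image_eq_zero (hd : 2 ≤ d)
    (h : IsDualPair C E (fun t => (Fin.cons 1 (p t) : Fin (d + 2) → ℝ)) Y (Fin.cons 1 0) m)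
    (hψpos : ∀ q, 0 < ψ q) (hψdec : Antitone ψ) (hs : (d : ℝ) / 2 < s) (hsd : s ≤ d + 1)
    (hsum : Summable fun k : ℕ => (ψ (2 ^ k) / 2 ^ k) ^ (s + 1) * (2 ^ k : ℝ) ^ (d + 2)) :
    μH[s] (simulApprox (d + 1) ψ ∩ p '' E) = 0 := by
  have hC := h.one_le
  have hs0 : 0 < s := lt_of_le_of_lt (by positivity) hs
  set θ : ℝ := ((d : ℝ) + 1 - s) / (s + 1) with hθ
  have hθ0 : 0 ≤ θ := div_nonneg (by linarith) (by linarith)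
  have hθ1 : θ < 1 := (div_lt_one (by linarith)).mpr (by linarith)
  obtain ⟨δ, hδ, hψδ, hηδ, hδ1, hδsum⟩ := exists_dyadic_scale (n := d + 1) (s := s)
    (A := (d + 2) * C) (η := (θ + 1) / 2) hψpos hψdec (by positivity) (by linarith)
    (by linarith) (by push_cast; linarith)
    (by
      have : θ * (s + 1) = d + 1 - s := div_mul_cancel₀ _ (by linarith)
      push_cast
      nlinarith) hsum
  obtain ⟨K, hK, hcount⟩ := exists_ncard_nearSet_le h (by simp) hd
    (τ := (θ + 1) / 2) (by linarith) (by linarith)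
  have hδ0 : ∀ k, 0 < δ k := fun k => lt_of_lt_of_le (by positivity) (hηδ k)
  have hr : Antitone fun k => δ k / 2 ^ k := fun j k hjk =>
    div_le_div₀ (hδ0 j).le (hδ hjk) (by positivity) (pow_le_pow_right₀ (by norm_num) hjk)
  have hfin := fun k : ℕ => finite_nearSet h (2 ^ (k + 1)) (δ k)
  refine hausdorffMeasure_eq_zero_of_frequently (fun k => (hfin k).toFinset)
    (fun w i => (w i.succ : ℝ) / w 0) (r := fun k => δ k / 2 ^ k)
    (fun k => div_nonneg (hδ0 k).le (by positivity)) hr ?_ hs0.le ?_ ?_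
  · have hlim : Filter.Tendsto (fun k : ℕ => δ 0 / 2 ^ k) Filter.atTop (nhds 0) :=
      tendsto_const_nhds.div_atTop (tendsto_pow_atTop_atTop_of_one_lt (by norm_num))
    refine squeeze_zero (fun k => div_nonneg (hδ0 k).le (by positivity)) (fun k => ?_) hlim
    have := hδ (Nat.zero_le k)
    gcongr
  · refine Summable.of_norm_bounded_eventually_nat (hδsum.mul_left (K * 2 ^ (d + 1))) ?_
    filter_upwards [hδ1] with k hk
    have hδk := hδ0 k
    have hcard := hcount (2 ^ (k + 1)) (δ k) (one_le_pow₀ (by norm_num))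
      (le_trans (Real.rpow_le_rpow_of_nonpos (by positivity)
        (pow_le_pow_right₀ (by norm_num) (Nat.le_succ k)) (by linarith)) (hηδ k)) hk
    rw [Set.ncard_eq_toFinset_card _ (hfin k)] at hcard
    rw [Real.norm_of_nonneg (by positivity)]
    refine (mul_le_mul_of_nonneg_right hcard (by positivity)).trans (le_of_eq ?_)
    rw [Real.rpow_add_one (by positivity), pow_succ (2 : ℝ) k, mul_pow]
    field_simp
    ring
  · rintro _ ⟨hx, t, ht, rfl⟩
    obtain ⟨N, hN⟩ := Filter.eventually_atTop.mp hδ1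
    refine Filter.frequently_atTop.mpr fun M => ?_
    obtain ⟨q, hq0, hqN, hq⟩ := exists_natAbs_ge_of_mem_simulApprox hx (2 ^ max M N)
    have hqabs : q.natAbs ≠ 0 := Int.natAbs_ne_zero.mpr hq0
    set k := Nat.log 2 q.natAbs with hk
    have hMk : max M N ≤ k := (Nat.le_log_iff_pow_le (by norm_num) hqabs).mpr hqN
    have hle : 2 ^ k ≤ q.natAbs := Nat.pow_log_le_self 2 hqabs
    have hlt : q.natAbs < 2 ^ (k + 1) := Nat.lt_pow_succ_log_self (by norm_num) _
    have hle' : (2 : ℝ) ^ k ≤ |(q : ℝ)| := by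
      rw [← Int.cast_abs, ← Nat.cast_natAbs]; exact_mod_cast hle
    have hlt' : |(q : ℝ)| ≤ 2 ^ (k + 1) := by
      rw [← Int.cast_abs, ← Nat.cast_natAbs]; exact_mod_cast hlt.le
    have hψk := hψpos (2 ^ k)
    have hqk : ∀ i, nint (q * p t i) ≤ ψ (2 ^ k) := fun i => (hq i).le.trans (hψdec hle)
    have hψδk : ψ (2 ^ k) ≤ δ k := by
      have : 1 ≤ ((d : ℝ) + 2) * C := by nlinarith [(Nat.cast_nonneg d : (0 : ℝ) ≤ d)]
      nlinarith [hψδ k]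
    refine ⟨k, le_of_max_le_left hMk, Fin.cons q fun i => round (q * p t i),
      (hfin k).mem_toFinset.mpr (cons_round_mem_nearSet h ht hlt' (one_le_pow₀ (by norm_num))
        (hN k (le_of_max_le_right hMk)) (hψδ k) hψk.le hqk), ?_⟩
    rw [dist_pi_le_iff (div_nonneg (hδ0 k).le (by positivity))]
    intro i
    have hq0' : (q : ℝ) ≠ 0 := Int.cast_ne_zero.mpr hq0
    have h1 : p t i - (round (q * p t i) : ℝ) / q = (q * p t i - round (q * p t i)) / q := by
      field_simp
    rw [Fin.cons_succ, Fin.cons_zero, Real.dist_eq, h1, abs_div]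
    exact div_le_div₀ (hδ0 k).le ((hqk i).trans hψδk) (by positivity) hle'

end Convergence

section Local

variable {ψ : ℕ → ℝ} {d : ℕ} {s : ℝ}

/-- The convergence theorem in a neighbourhood of a point of nonvanishing curvature. -/
lemma exists_nhds_hausdorffMeasure_eq_zero (hd : 2 ≤ d) (hψpos : ∀ q, 0 < ψ q)
    (hψdec : Antitone ψ) (hs : (d : ℝ) / 2 < s) (hsd : s ≤ d + 1)
    (hsum : Summable fun k : ℕ => (ψ (2 ^ k) / 2 ^ k) ^ (s + 1) * (2 ^ k : ℝ) ^ (d + 2))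
    {S : Set (Fin (d + 1) → ℝ)} {O : Matrix (Fin (d + 1)) (Fin (d + 1)) ℝ}
    (hO : O ∈ Matrix.orthogonalGroup (Fin (d + 1)) ℝ) {D : Set (Fin d → ℝ)}
    {f : (Fin d → ℝ) → ℝ} {y₀ : Fin d → ℝ} (hf : ContDiffAt ℝ 2 f y₀)
    (hdet : (hess f y₀).det ≠ 0) {ε : ℝ} (hε : 0 < ε)
    (hS : S ∩ Metric.ball (O.mulVec (appendV (d + 1) d y₀ (f y₀))) ε ⊆
      O.mulVec '' {p | ∃ y ∈ D, p = appendV (d + 1) d y (f y)}) :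
    ∃ U ∈ nhds (O.mulVec (appendV (d + 1) d y₀ (f y₀))),
      μH[s] (simulApprox (d + 1) ψ ∩ (S ∩ U)) = 0 := by
  obtain ⟨C, ρ, hρ, h⟩ := isDualPair_graph hO hf hdet
  obtain ⟨c, hc, hcO⟩ := exists_norm_mulVec_equiv hO
  refine ⟨Metric.ball _ (min ε (ρ / c)), Metric.ball_mem_nhds _ (by positivity),
    measure_mono_null ?_ (hausdorffMeasure_simulApprox_inter_image_eq_zero
      (p := fun t => O.mulVec (appendV (d + 1) d t (f t))) hd h hψpos hψdec hs hsd hsum)⟩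
  rintro x ⟨hxψ, hxS, hx⟩
  refine ⟨hxψ, ?_⟩
  have hx' := Metric.mem_ball.mp hx
  obtain ⟨_, ⟨y, -, rfl⟩, rfl⟩ := hS ⟨hxS, Metric.ball_subset_ball (min_le_left _ _) hx⟩
  refine ⟨y, ?_, rfl⟩
  rw [dist_eq_norm, ← Matrix.mulVec_sub, appendV_sub] at hx'
  rw [Metric.mem_ball, dist_eq_norm]
  calc ‖y - y₀‖ ≤ ‖appendV (d + 1) d (y - y₀) (f y - f y₀)‖ := norm_le_norm_appendV _ _
    _ ≤ c * ‖O.mulVec (appendV (d + 1) d (y - y₀) (f y - f y₀))‖ := (hcO _).2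
    _ < c * (ρ / c) := by
        have := hx'.trans_le (min_le_right _ _)
        gcongr
    _ = ρ := by field_simp

end Local

theorem statement5 (n : ℕ) (hn : 3 ≤ n) (l : ℕ)
    (hl : l = max ((n - 1) / 2 + 5) (n + 1))
    (ψ : ℕ → ℝ) (hψpos : ∀ q, 0 < ψ q) (hψdec : Antitone ψ)
    (s : ℝ) (hs : ((n : ℝ) - 1) / 2 < s)
    (S : Set (Fin n → ℝ)) (hScomp : IsCompact S)
    -- `S` is a `C^l` hypersurface whose Gaussian curvature is nonvanishing
    -- everywhere except possibly on a set `Z` of zero Hausdorff `s`-measure.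
    (Z : Set (Fin n → ℝ)) (hZ : μH[s] Z = 0)
    (hchart : ∀ x ∈ S, ∃ O : Matrix (Fin n) (Fin n) ℝ,
      O ∈ Matrix.orthogonalGroup (Fin n) ℝ ∧
      ∃ D : Set (Fin (n - 1) → ℝ), IsOpen D ∧
      ∃ f : (Fin (n - 1) → ℝ) → ℝ, ContDiffOn ℝ (l : ℕ∞) f D ∧
      ∃ y₀ ∈ D, x = O.mulVec (appendV n (n - 1) y₀ (f y₀)) ∧
      (∃ ε > (0 : ℝ), S ∩ Metric.ball x ε =
        (O.mulVec '' {p | ∃ y ∈ D, p = appendV n (n - 1) y (f y)}) ∩ Metric.ball x ε) ∧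
      (x ∉ Z → (hess f y₀).det ≠ 0))
    (hsum : Summable fun q : ℕ =>
      (ψ (q + 1) / ((q : ℝ) + 1)) ^ (s + 1) * ((q : ℝ) + 1) ^ n) :
    μH[s] (simulApprox n ψ ∩ S) = 0 := by
  obtain ⟨d, rfl⟩ : ∃ d, n = d + 1 := ⟨n - 1, by omega⟩
  have hd : 2 ≤ d := by omega
  have hs' : (d : ℝ) / 2 < s := by
    push_cast at hs
    linarith
  have hs0 : 0 < s := lt_of_le_of_lt (by positivity) hs'
  by_cases hsd : s ≤ d + 1
  · have hdyadic := summable_dyadic hψpos hψdec (by linarith) hsum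
    have hnull : μH[s] ((simulApprox (d + 1) ψ ∩ S) \ Z) = 0 := by
      refine measure_null_of_locally_null _ fun x hx => ?_
      obtain ⟨O, hO, D, hD, f, hf, y₀, hy₀, hxy, ⟨ε, hε, hball⟩, hcurv⟩ := hchart x hx.1.2
      have hl2 : 2 ≤ l := by omega
      have hf2 : ContDiffAt ℝ 2 f y₀ :=
        (hf.contDiffAt (hD.mem_nhds hy₀)).of_le (WithTop.coe_le_coe.mpr (Nat.cast_le.mpr hl2))
      rw [hxy] at hball
      obtain ⟨U, hU, hU0⟩ := exists_nhds_hausdorffMeasure_eq_zero hd hψpos hψdec hs' hsd hdyadic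
        hO hf2 (hcurv hx.2) hε (hball.subset.trans Set.inter_subset_left)
      refine ⟨U ∩ ((simulApprox (d + 1) ψ ∩ S) \ Z), ?_, measure_mono_null ?_ hU0⟩
      · rw [hxy]
        exact Filter.inter_mem (mem_nhdsWithin_of_mem_nhds hU) (hxy ▸ self_mem_nhdsWithin)
      · exact fun z hz => ⟨hz.2.1.1, hz.2.1.2, hz.1⟩
    exact measure_mono_null (fun z hz => or_iff_not_imp_left.mpr fun hzZ => ⟨hz, hzZ⟩)
      (measure_union_null hZ hnull)
  · have hdim : (Module.finrank ℝ (Fin (d + 1) → ℝ) : ℝ) < s := by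
      rw [Module.finrank_fin_fun]
      push_cast
      linarith
    rw [Real.hausdorffMeasure_of_finrank_lt hdim]
    rfl
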